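/- arXiv:2005.06116 — 3 statements merged into one kernel-verified Lean document; each statement's English description precedes it below -/
import Mathlib

section
/- Let κ > 0 and C > 0, and let τ : [0,∞) → ℂ be measurable and bounded. Suppose there exists a function G holomorphic on an open set containing Ω = {s ∈ ℂ : Re s ≥ −C/(1 + |Im s|)^κ} such that G(s) = ∫₀^∞ τ(t) e^{−st} dt for every s with Re s > 0, and suppose there exist constants M > 0 and N ≥ 0 with |G(s)| ≤ M(1 + |s|)^N for all s ∈ Ω. Then there exists a constant K such that |∫₀^x τ(t) dt − G(0)| ≤ K (log x / x)^{1/κ} for all x ≥ 2. -/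
open MeasureTheory Set Filter

/-- The part over `0 ≤ Re z` of the counterclockwise integral of `f` along the boundary of the
rectangle `|Re z| ≤ b`, `|Im z| ≤ R`. -/
noncomputable def rightPathIntegral (f : ℂ → ℂ) (b R : ℝ) : ℂ :=
  (∫ σ in (0:ℝ)..b, f (σ + (-R : ℝ) * Complex.I)) - (∫ σ in (0:ℝ)..b, f (σ + R * Complex.I))
    + Complex.I * ∫ y in (-R)..R, f (b + y * Complex.I)

/-- The part over `Re z ≤ 0` of the counterclockwise integral of `f` along the boundary of the
rectangle `|Re z| ≤ a`, `|Im z| ≤ R`. -/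
noncomputable def leftPathIntegral (f : ℂ → ℂ) (a R : ℝ) : ℂ :=
  (∫ σ in (-a)..0, f (σ + (-R : ℝ) * Complex.I)) - (∫ σ in (-a)..0, f (σ + R * Complex.I))
    - Complex.I * ∫ y in (-R)..R, f ((-a : ℝ) + y * Complex.I)

/-- The closed rectangle `[-a, b] × [-R, R]`. -/
def closedRect (a b R : ℝ) : Set ℂ := Icc (-a) b ×ℂ Icc (-R) R

theorem mem_closedRect {a b R : ℝ} {z : ℂ} :
    z ∈ closedRect a b R ↔ (-a ≤ z.re ∧ z.re ≤ b) ∧ (-R ≤ z.im ∧ z.im ≤ R) := by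
  simp [closedRect, Complex.mem_reProdIm]

theorem intervalIntegrable_horizontal {f : ℂ → ℂ} {a b R : ℝ}
    (hf : ContinuousOn f (closedRect a b R \ {0})) {c d y : ℝ} (hc : c ∈ Icc (-a) b)
    (hd : d ∈ Icc (-a) b) (hy : y ∈ Icc (-R) R) (hy0 : y ≠ 0) :
    IntervalIntegrable (fun σ : ℝ => f (σ + y * Complex.I)) volume c d := by
  apply ContinuousOn.intervalIntegrable
  refine hf.comp (by fun_prop) fun σ hσ => ?_
  have hσ' := (uIcc_subset_Icc hc hd) hσ
  refine ⟨mem_closedRect.2 (by simpa using ⟨hσ', hy⟩), fun h => hy0 ?_⟩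
  simpa using congrArg Complex.im h

theorem intervalIntegrable_vertical {f : ℂ → ℂ} {a b R : ℝ} (hR : 0 < R)
    (hf : ContinuousOn f (closedRect a b R \ {0})) {c : ℝ} (hc : c ∈ Icc (-a) b)
    (hc0 : c ≠ 0) :
    IntervalIntegrable (fun y : ℝ => f (c + y * Complex.I)) volume (-R) R := by
  apply ContinuousOn.intervalIntegrable
  refine hf.comp (by fun_prop) fun y hy => ?_
  rw [uIcc_of_le (by linarith)] at hy
  refine ⟨mem_closedRect.2 (by simpa using ⟨hc, hy⟩), fun h => hc0 ?_⟩
  simpa using congrArg Complex.re h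

theorem rightPathIntegral_sub {f g : ℂ → ℂ} {a b R : ℝ} (ha : 0 ≤ a) (hb : 0 < b) (hR : 0 < R)
    (hf : ContinuousOn f (closedRect a b R \ {0}))
    (hg : ContinuousOn g (closedRect a b R \ {0})) :
    rightPathIntegral (fun z => f z - g z) b R
      = rightPathIntegral f b R - rightPathIntegral g b R := by
  have h0 : (0:ℝ) ∈ Icc (-a) b := ⟨by linarith, hb.le⟩
  have h1 : b ∈ Icc (-a) b := ⟨by linarith, le_rfl⟩
  have h2 : R ∈ Icc (-R) R := ⟨by linarith, le_rfl⟩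
  have h3 : -R ∈ Icc (-R) R := ⟨le_rfl, by linarith⟩
  unfold rightPathIntegral
  rw [intervalIntegral.integral_sub
      (intervalIntegrable_horizontal hf h0 h1 h3 (by linarith))
      (intervalIntegrable_horizontal hg h0 h1 h3 (by linarith)),
    intervalIntegral.integral_sub
      (intervalIntegrable_horizontal hf h0 h1 h2 hR.ne')
      (intervalIntegrable_horizontal hg h0 h1 h2 hR.ne'),
    intervalIntegral.integral_sub
      (intervalIntegrable_vertical hR hf h1 hb.ne') (intervalIntegrable_vertical hR hg h1 hb.ne')]
  ring

theorem leftPathIntegral_sub {f g : ℂ → ℂ} {a b R : ℝ} (ha : 0 < a) (hb : 0 ≤ b) (hR : 0 < R)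
    (hf : ContinuousOn f (closedRect a b R \ {0}))
    (hg : ContinuousOn g (closedRect a b R \ {0})) :
    leftPathIntegral (fun z => f z - g z) a R
      = leftPathIntegral f a R - leftPathIntegral g a R := by
  have h0 : (0:ℝ) ∈ Icc (-a) b := ⟨by linarith, hb⟩
  have h1 : -a ∈ Icc (-a) b := ⟨le_rfl, by linarith⟩
  have h2 : R ∈ Icc (-R) R := ⟨by linarith, le_rfl⟩
  have h3 : -R ∈ Icc (-R) R := ⟨le_rfl, by linarith⟩
  unfold leftPathIntegral
  rw [intervalIntegral.integral_sub
      (intervalIntegrable_horizontal hf h1 h0 h3 (by linarith))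
      (intervalIntegrable_horizontal hg h1 h0 h3 (by linarith)),
    intervalIntegral.integral_sub
      (intervalIntegrable_horizontal hf h1 h0 h2 hR.ne')
      (intervalIntegrable_horizontal hg h1 h0 h2 hR.ne'),
    intervalIntegral.integral_sub
      (intervalIntegrable_vertical hR hf h1 (by linarith))
      (intervalIntegrable_vertical hR hg h1 (by linarith))]
  ring

theorem rightPathIntegral_const_mul (c : ℂ) (f : ℂ → ℂ) (b R : ℝ) :
    rightPathIntegral (fun z => c * f z) b R = c * rightPathIntegral f b R := by
  simp only [rightPathIntegral, intervalIntegral.integral_const_mul]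
  ring

theorem leftPathIntegral_const_mul (c : ℂ) (f : ℂ → ℂ) (a R : ℝ) :
    leftPathIntegral (fun z => c * f z) a R = c * leftPathIntegral f a R := by
  simp only [leftPathIntegral, intervalIntegral.integral_const_mul]
  ring

theorem norm_rightPathIntegral_le {f : ℂ → ℂ} {b R D : ℝ} (hb : 0 < b) (hR : 0 < R)
    (hh : ∀ z : ℂ, 0 < z.re → z.re ≤ b → |z.im| = R → ‖f z‖ ≤ D)
    (hv : ∀ z : ℂ, z.re = b → |z.im| ≤ R → ‖f z‖ ≤ D) :
    ‖rightPathIntegral f b R‖ ≤ 2 * b * D + 2 * R * D := by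
  have h1 : ∀ y : ℝ, |y| = R → ‖∫ σ in (0:ℝ)..b, f (σ + y * Complex.I)‖ ≤ D * |b - 0| := by
    intro y hy
    refine intervalIntegral.norm_integral_le_of_norm_le_const fun σ hσ => ?_
    rw [uIoc_of_le hb.le] at hσ
    exact hh _ (by simpa using hσ.1) (by simpa using hσ.2) (by simpa using hy)
  have h2 : ‖∫ y in (-R)..R, f (b + y * Complex.I)‖ ≤ D * |R - -R| := by
    refine intervalIntegral.norm_integral_le_of_norm_le_const fun y hy => ?_
    rw [uIoc_of_le (by linarith)] at hy
    exact hv _ (by simp) (by simpa [abs_le] using ⟨hy.1.le, hy.2⟩)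
  have h3 := h1 R (abs_of_pos hR)
  have h4 := h1 (-R) (by rw [abs_neg, abs_of_pos hR])
  rw [abs_of_pos (by linarith)] at h2 h3 h4
  unfold rightPathIntegral
  refine (norm_add_le _ _).trans ?_
  rw [norm_mul, Complex.norm_I, one_mul]
  have := norm_sub_le (∫ σ in (0:ℝ)..b, f (σ + (-R : ℝ) * Complex.I))
    (∫ σ in (0:ℝ)..b, f (σ + R * Complex.I))
  linarith

theorem norm_leftPathIntegral_le {f : ℂ → ℂ} {a R D E : ℝ} (ha : 0 < a) (hR : 0 < R)
    (hh : ∀ z : ℂ, -a ≤ z.re → z.re ≤ 0 → |z.im| = R → ‖f z‖ ≤ D)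
    (hv : ∀ z : ℂ, z.re = -a → |z.im| ≤ R → ‖f z‖ ≤ E) :
    ‖leftPathIntegral f a R‖ ≤ 2 * a * D + 2 * R * E := by
  have h1 : ∀ y : ℝ, |y| = R → ‖∫ σ in (-a)..0, f (σ + y * Complex.I)‖ ≤ D * |0 - -a| := by
    intro y hy
    refine intervalIntegral.norm_integral_le_of_norm_le_const fun σ hσ => ?_
    rw [uIoc_of_le (by linarith)] at hσ
    exact hh _ (by simpa using hσ.1.le) (by simpa using hσ.2) (by simpa using hy)
  have h2 : ‖∫ y in (-R)..R, f ((-a : ℝ) + y * Complex.I)‖ ≤ E * |R - -R| := by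
    refine intervalIntegral.norm_integral_le_of_norm_le_const fun y hy => ?_
    rw [uIoc_of_le (by linarith)] at hy
    exact hv _ (by simp) (by simpa [abs_le] using ⟨hy.1.le, hy.2⟩)
  have h3 := h1 R (abs_of_pos hR)
  have h4 := h1 (-R) (by rw [abs_neg, abs_of_pos hR])
  rw [abs_of_pos (by linarith)] at h2 h3 h4
  unfold leftPathIntegral
  refine (norm_sub_le _ _).trans ?_
  rw [norm_mul, Complex.norm_I, one_mul]
  have := norm_sub_le (∫ σ in (-a)..0, f (σ + (-R : ℝ) * Complex.I))
    (∫ σ in (-a)..0, f (σ + R * Complex.I))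
  linarith

theorem pathIntegral_eq_zero_of_differentiableOn {f : ℂ → ℂ} {a b R : ℝ} (ha : 0 ≤ a)
    (hb : 0 ≤ b) (hR : 0 < R) (hf : DifferentiableOn ℂ f (closedRect a b R)) :
    rightPathIntegral f b R + leftPathIntegral f a R = 0 := by
  have h0 : (0:ℝ) ∈ Icc (-a) b := ⟨by linarith, hb⟩
  have h1 : b ∈ Icc (-a) b := ⟨by linarith, le_rfl⟩
  have h4 : -a ∈ Icc (-a) b := ⟨le_rfl, by linarith⟩
  have h2 : R ∈ Icc (-R) R := ⟨by linarith, le_rfl⟩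
  have h3 : -R ∈ Icc (-R) R := ⟨le_rfl, by linarith⟩
  have hc : ContinuousOn f (closedRect a b R \ {0}) := hf.continuousOn.mono sdiff_subset
  have key := Complex.integral_boundary_rect_eq_zero_of_differentiableOn f ⟨-a, -R⟩ ⟨b, R⟩
    (by
      rw [uIcc_of_le (by simp; linarith), uIcc_of_le (by simp; linarith)]
      exact hf)
  simp only at key
  rw [← intervalIntegral.integral_add_adjacent_intervals
      (intervalIntegrable_horizontal hc h4 h0 h3 (by linarith))
      (intervalIntegrable_horizontal hc h0 h1 h3 (by linarith)),
    ← intervalIntegral.integral_add_adjacent_intervals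
      (intervalIntegrable_horizontal hc h4 h0 h2 hR.ne')
      (intervalIntegrable_horizontal hc h0 h1 h2 hR.ne')] at key
  rw [← key, rightPathIntegral, leftPathIntegral]
  simp only [smul_eq_mul]
  ring

theorem integral_inv_horizontal {a b y : ℝ} (hy : y ≠ 0) :
    ∫ σ in a..b, ((σ : ℂ) + y * Complex.I)⁻¹
      = Complex.log (b + y * Complex.I) - Complex.log (a + y * Complex.I) := by
  have hne : ∀ σ : ℝ, (σ : ℂ) + y * Complex.I ≠ 0 := fun σ h =>
    hy (by simpa using congrArg Complex.im h)
  refine intervalIntegral.integral_eq_sub_of_hasDerivAt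
    (f := fun σ : ℝ => Complex.log (σ + y * Complex.I)) (fun σ _ => ?_) ?_
  · have h := ((hasDerivAt_id (σ : ℂ)).add_const ((y : ℂ) * Complex.I)).clog
      (Or.inr (by simpa using hy))
    simpa using h.comp_ofReal
  · exact (Continuous.inv₀ (by fun_prop) hne).intervalIntegrable _ _

theorem integral_inv_vertical_of_pos {a c d : ℝ} (ha : 0 < a) :
    Complex.I * ∫ y in c..d, ((a : ℂ) + y * Complex.I)⁻¹
      = Complex.log (a + d * Complex.I) - Complex.log (a + c * Complex.I) := by
  have hne : ∀ y : ℝ, (a : ℂ) + y * Complex.I ≠ 0 := fun y h =>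
    ha.ne' (by simpa using congrArg Complex.re h)
  rw [← intervalIntegral.integral_const_mul]
  refine intervalIntegral.integral_eq_sub_of_hasDerivAt
    (f := fun y : ℝ => Complex.log (a + y * Complex.I)) (fun y _ => ?_) ?_
  · have h := (((hasDerivAt_id (y : ℂ)).mul_const Complex.I).const_add (a : ℂ)).clog
      (Or.inl (by simpa using ha))
    simpa [div_eq_mul_inv] using h.comp_ofReal
  · exact (continuous_const.mul (Continuous.inv₀ (by fun_prop) hne)).intervalIntegrable _ _

theorem pathIntegral_inv {a b R : ℝ} (ha : 0 < a) (hb : 0 < b) (hR : 0 < R) :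
    rightPathIntegral (fun z => z⁻¹) b R + leftPathIntegral (fun z => z⁻¹) a R
      = 2 * Real.pi * Complex.I := by
  have hleft : Complex.I * ∫ y in (-R)..R, (((-a : ℝ) : ℂ) + y * Complex.I)⁻¹
      = Complex.log (a + (-R : ℝ) * Complex.I) - Complex.log (a + R * Complex.I) := by
    have h : ∀ y : ℝ, (((-a : ℝ) : ℂ) + y * Complex.I)⁻¹
        = -((a : ℂ) + (-y : ℝ) * Complex.I)⁻¹ := fun y => by
      rw [← inv_neg]; congr 1; push_cast; ring
    simp only [h]
    rw [intervalIntegral.integral_neg,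
      intervalIntegral.integral_comp_neg (fun y : ℝ => ((a : ℂ) + y * Complex.I)⁻¹), neg_neg,
      mul_neg, integral_inv_vertical_of_pos ha]
    ring
  have hlog : ∀ z : ℂ, 0 < z.im → Complex.log (-z) = Complex.log z - Real.pi * Complex.I := by
    intro z hz
    simp only [Complex.log, norm_neg, Complex.arg_neg_eq_arg_sub_pi_of_im_pos hz]
    push_cast
    ring
  have e1 := hlog (a + R * Complex.I) (by simpa using hR)
  have e2 := hlog ((-a : ℝ) + R * Complex.I) (by simpa using hR)
  have e3 : -((a : ℂ) + R * Complex.I) = (-a : ℝ) + (-R : ℝ) * Complex.I := by push_cast; ring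
  have e4 : -(((-a : ℝ) : ℂ) + R * Complex.I) = a + (-R : ℝ) * Complex.I := by push_cast; ring
  rw [e3] at e1
  rw [e4] at e2
  rw [rightPathIntegral, leftPathIntegral, hleft, integral_inv_vertical_of_pos hb,
    integral_inv_horizontal (neg_ne_zero.2 hR.ne'), integral_inv_horizontal hR.ne',
    integral_inv_horizontal (neg_ne_zero.2 hR.ne'), integral_inv_horizontal hR.ne', e1, e2]
  ring

/-- Cauchy's integral formula at the origin for a rectangle. -/
theorem pathIntegral_div_self {g : ℂ → ℂ} {U : Set ℂ} {a b R : ℝ} (ha : 0 < a) (hb : 0 < b)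
    (hR : 0 < R) (hU : IsOpen U) (hsub : closedRect a b R ⊆ U) (hg : DifferentiableOn ℂ g U) :
    rightPathIntegral (fun z => g z / z) b R + leftPathIntegral (fun z => g z / z) a R
      = 2 * Real.pi * Complex.I * g 0 := by
  have h0 : (0:ℂ) ∈ U := hsub (mem_closedRect.2 (by simp; exact ⟨⟨ha.le, hb.le⟩, hR.le⟩))
  have hd : DifferentiableOn ℂ (dslope g 0) (closedRect a b R) :=
    ((Complex.differentiableOn_dslope (hU.mem_nhds h0)).2 hg).mono hsub
  have hcauchy := pathIntegral_eq_zero_of_differentiableOn ha.le hb.le hR hd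
  have hgc : ContinuousOn (fun z => g z / z) (closedRect a b R \ {0}) :=
    (hg.continuousOn.mono (sdiff_subset.trans hsub)).div continuousOn_id fun z hz => hz.2
  have hic : ContinuousOn (fun z : ℂ => g 0 * z⁻¹) (closedRect a b R \ {0}) :=
    continuousOn_const.mul (continuousOn_id.inv₀ fun z hz => hz.2)
  have hne : ∀ z : ℂ, z ≠ 0 → dslope g 0 z = g z / z - g 0 * z⁻¹ := by
    intro z hz
    rw [dslope_of_ne _ hz, slope_def_field, sub_zero]
    ring
  have hr : rightPathIntegral (dslope g 0) b R
      = rightPathIntegral (fun z => g z / z - g 0 * z⁻¹) b R := by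
    unfold rightPathIntegral
    have him : ∀ σ y : ℝ, y ≠ 0 → (σ : ℂ) + y * Complex.I ≠ 0 := fun σ y hy h =>
      hy (by simpa using congrArg Complex.im h)
    have hre : ∀ y : ℝ, (b : ℂ) + y * Complex.I ≠ 0 := fun y h =>
      hb.ne' (by simpa using congrArg Complex.re h)
    simp only [hne _ (him _ _ hR.ne'), hne _ (him _ _ (neg_ne_zero.2 hR.ne')), hne _ (hre _)]
  have hl : leftPathIntegral (dslope g 0) a R
      = leftPathIntegral (fun z => g z / z - g 0 * z⁻¹) a R := by
    unfold leftPathIntegral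
    have him : ∀ σ y : ℝ, y ≠ 0 → (σ : ℂ) + y * Complex.I ≠ 0 := fun σ y hy h =>
      hy (by simpa using congrArg Complex.im h)
    have hre : ∀ y : ℝ, ((-a : ℝ) : ℂ) + y * Complex.I ≠ 0 := fun y h =>
      ha.ne' (by simpa using congrArg Complex.re h)
    simp only [hne _ (him _ _ hR.ne'), hne _ (him _ _ (neg_ne_zero.2 hR.ne')), hne _ (hre _)]
  rw [hr, hl, rightPathIntegral_sub ha.le hb hR hgc hic, leftPathIntegral_sub ha hb.le hR hgc hic,
    rightPathIntegral_const_mul, leftPathIntegral_const_mul] at hcauchy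
  linear_combination hcauchy + g 0 * pathIntegral_inv ha hb hR

/-- The Laplace transform of the restriction of `τ` to `[0, x]`. -/
noncomputable def truncatedLaplace (τ : ℝ → ℂ) (x : ℝ) (z : ℂ) : ℂ :=
  ∫ t in (0:ℝ)..x, τ t * Complex.exp (-(z * t))

theorem norm_mul_cexp_neg_le {τ : ℝ → ℂ} {B : ℝ} (hbdd : ∀ t : ℝ, 0 ≤ t → ‖τ t‖ ≤ B)
    (z : ℂ) {t : ℝ} (ht : 0 ≤ t) :
    ‖τ t * Complex.exp (-(z * t))‖ ≤ B * Real.exp (-z.re * t) := by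
  rw [norm_mul, Complex.norm_exp]
  have : (-(z * t)).re = -z.re * t := by simp
  rw [this]
  exact mul_le_mul_of_nonneg_right (hbdd t ht) (Real.exp_nonneg _)

theorem intervalIntegrable_mul_of_bounded {τ : ℝ → ℂ} (hmeas : Measurable τ) {B : ℝ}
    (hbdd : ∀ t : ℝ, 0 ≤ t → ‖τ t‖ ≤ B) {x : ℝ} (hx : 0 ≤ x) {φ : ℝ → ℂ} (hφ : Continuous φ) :
    IntervalIntegrable (fun t => τ t * φ t) volume 0 x := by
  have hτ : IntervalIntegrable τ volume 0 x := by
    refine IntervalIntegrable.mono_fun' (g := fun _ => B) (by simp)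
      hmeas.aestronglyMeasurable ?_
    rw [uIoc_of_le hx]
    exact (ae_restrict_iff' measurableSet_Ioc).2 (.of_forall fun t ht => hbdd t ht.1.le)
  exact hτ.mul_continuousOn hφ.continuousOn

theorem differentiable_truncatedLaplace {τ : ℝ → ℂ} (hmeas : Measurable τ) {B : ℝ}
    (hbdd : ∀ t : ℝ, 0 ≤ t → ‖τ t‖ ≤ B) {x : ℝ} (hx : 0 ≤ x) :
    Differentiable ℂ (truncatedLaplace τ x) := by
  intro z₀
  have hB : 0 ≤ B := (norm_nonneg _).trans (hbdd 0 le_rfl)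
  refine (intervalIntegral.hasDerivAt_integral_of_dominated_loc_of_deriv_le
    (F := fun z t => τ t * Complex.exp (-(z * t)))
    (F' := fun z t => τ t * (Complex.exp (-(z * t)) * -(t : ℂ)))
    (bound := fun _ => B * (Real.exp ((‖z₀‖ + 1) * x) * x)) (s := Metric.ball z₀ 1)
    (Metric.ball_mem_nhds _ one_pos) (.of_forall fun z => ?_) ?_ ?_ ?_ (by simp)
    ?_).2.differentiableAt
  · exact (hmeas.mul (Continuous.measurable (by fun_prop))).aestronglyMeasurable
  · exact intervalIntegrable_mul_of_bounded hmeas hbdd hx (by fun_prop)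
  · exact (hmeas.mul (Continuous.measurable (by fun_prop))).aestronglyMeasurable
  · refine .of_forall fun t ht z hz => ?_
    rw [uIoc_of_le hx] at ht
    have hz' : ‖z‖ ≤ ‖z₀‖ + 1 := by
      have h1 := norm_add_le (z - z₀) z₀
      rw [sub_add_cancel] at h1
      have h2 : ‖z - z₀‖ < 1 := by simpa [dist_eq_norm] using hz
      linarith
    rw [norm_mul, norm_mul, norm_neg, Complex.norm_real, Real.norm_of_nonneg ht.1.le]
    have he : ‖Complex.exp (-(z * t))‖ ≤ Real.exp ((‖z₀‖ + 1) * x) := by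
      refine (Complex.norm_exp_le_exp_norm _).trans (Real.exp_le_exp.2 ?_)
      rw [norm_neg, norm_mul, Complex.norm_real, Real.norm_of_nonneg ht.1.le]
      exact mul_le_mul hz' ht.2 ht.1.le (by positivity)
    have := hbdd t ht.1.le
    have := ht.1.le
    have := ht.2
    gcongr
  · refine .of_forall fun t _ z _ => ?_
    have h := (((hasDerivAt_id z).mul_const (t : ℂ)).neg.cexp).const_mul (τ t)
    simpa using h

theorem norm_truncatedLaplace_mul_le {τ : ℝ → ℂ} {B : ℝ}
    (hbdd : ∀ t : ℝ, 0 ≤ t → ‖τ t‖ ≤ B) {x : ℝ} (hx : 0 ≤ x) {z : ℂ} (hz : z.re ≤ 0) :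
    ‖truncatedLaplace τ x z‖ * |z.re| ≤ B * Real.exp (-z.re * x) := by
  have hB : 0 ≤ B := (norm_nonneg _).trans (hbdd 0 le_rfl)
  rcases hz.eq_or_lt with hz0 | hz0
  · rw [hz0]
    simpa using hB
  have h1 : ‖truncatedLaplace τ x z‖ ≤ ∫ t in (0:ℝ)..x, B * Real.exp (-z.re * t) := by
    refine intervalIntegral.norm_integral_le_of_norm_le hx
      (.of_forall fun t ht => norm_mul_cexp_neg_le hbdd z ht.1.le) ?_
    exact Continuous.intervalIntegrable (by fun_prop) _ _
  rw [intervalIntegral.integral_const_mul, intervalIntegral.integral_comp_mul_left _ (by linarith),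
    integral_exp] at h1
  rw [abs_of_neg hz0]
  calc ‖truncatedLaplace τ x z‖ * -z.re
      ≤ _ * -z.re := mul_le_mul_of_nonneg_right h1 (by linarith)
    _ = B * (Real.exp (-z.re * x) - 1) := by
        have : z.re ≠ 0 := hz0.ne
        simp
        field_simp
    _ ≤ B * Real.exp (-z.re * x) := by gcongr; linarith

theorem norm_sub_truncatedLaplace_mul_le {τ : ℝ → ℂ} (hmeas : Measurable τ) {B : ℝ}
    (hbdd : ∀ t : ℝ, 0 ≤ t → ‖τ t‖ ≤ B) {x : ℝ} (hx : 0 ≤ x) {z : ℂ} (hz : 0 < z.re) :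
    ‖(∫ t in Ioi (0:ℝ), τ t * Complex.exp (-(z * t))) - truncatedLaplace τ x z‖ * |z.re|
      ≤ B * Real.exp (-z.re * x) := by
  have hexp : ∀ c : ℝ, IntegrableOn (fun t => B * Real.exp (-z.re * t)) (Ioi c) := fun c =>
    (integrableOn_exp_mul_Ioi (by linarith) c).const_mul B
  have hint : IntegrableOn (fun t : ℝ => τ t * Complex.exp (-(z * t))) (Ioi 0) := by
    refine Integrable.mono' (hexp 0)
      (hmeas.mul (Continuous.measurable (by fun_prop))).aestronglyMeasurable ?_
    exact (ae_restrict_iff' measurableSet_Ioi).2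
      (.of_forall fun t ht => norm_mul_cexp_neg_le hbdd z (le_of_lt ht))
  have hsplit : (∫ t in Ioi (0:ℝ), τ t * Complex.exp (-(z * t))) - truncatedLaplace τ x z
      = ∫ t in Ioi x, τ t * Complex.exp (-(z * t)) := by
    rw [truncatedLaplace, ← intervalIntegral.integral_Ioi_sub_Ioi hint hx, sub_sub_cancel]
  have h1 : ‖∫ t in Ioi x, τ t * Complex.exp (-(z * t))‖
      ≤ ∫ t in Ioi x, B * Real.exp (-z.re * t) :=
    norm_integral_le_of_norm_le (hexp x) ((ae_restrict_iff' measurableSet_Ioi).2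
      (.of_forall fun t ht => norm_mul_cexp_neg_le hbdd z (hx.trans (le_of_lt ht))))
  rw [integral_const_mul, integral_exp_mul_Ioi (by linarith)] at h1
  rw [hsplit, abs_of_pos hz]
  refine (mul_le_mul_of_nonneg_right h1 hz.le).trans_eq ?_
  have : z.re ≠ 0 := hz.ne'
  field_simp

theorem norm_one_add_sq_div_sq_le_three {R : ℝ} (hR : 0 < R) {z : ℂ} (hre : |z.re| ≤ R)
    (him : |z.im| ≤ R) : ‖1 + z ^ 2 / (R : ℂ) ^ 2‖ ≤ 3 := by
  have hn : ‖z‖ ^ 2 ≤ 2 * R ^ 2 := by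
    rw [Complex.sq_norm, Complex.normSq_apply]
    have h1 := sq_abs z.re
    have h2 := sq_abs z.im
    nlinarith [abs_nonneg z.re, abs_nonneg z.im]
  refine (norm_add_le _ _).trans ?_
  rw [norm_one, norm_div, norm_pow, norm_pow, Complex.norm_real, Real.norm_of_nonneg hR.le]
  have : ‖z‖ ^ 2 / R ^ 2 ≤ 2 := by rw [div_le_iff₀ (by positivity)]; linarith
  linarith

/-- Newman's kernel `1 + z² / R²` is small near the imaginary axis on the boundary of the
square of half-width `R`. -/
theorem norm_one_add_sq_div_sq_le {R : ℝ} (hR : 0 < R) {z : ℂ} (hre : |z.re| ≤ R)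
    (him : |z.im| ≤ R) (hz : |z.re| = R ∨ |z.im| = R) :
    ‖1 + z ^ 2 / (R : ℂ) ^ 2‖ ≤ 3 * (|z.re| / R) := by
  rcases hz with hz | hz
  · rw [hz, div_self hR.ne', mul_one]
    exact norm_one_add_sq_div_sq_le_three hR hre him
  · have hRc : (R : ℂ) ≠ 0 := by exact_mod_cast hR.ne'
    have hsq : (z.im : ℂ) ^ 2 = (R : ℂ) ^ 2 := by
      have : z.im ^ 2 = R ^ 2 := by rw [← sq_abs, hz]
      exact_mod_cast this
    have he : 1 + z ^ 2 / (R : ℂ) ^ 2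
        = z.re * (z.re + 2 * z.im * Complex.I) / (R : ℂ) ^ 2 := by
      rw [eq_div_iff (pow_ne_zero 2 hRc), add_mul, div_mul_cancel₀ _ (pow_ne_zero 2 hRc), one_mul,
        ← hsq]
      nth_rewrite 2 [← Complex.re_add_im z]
      linear_combination (z.im : ℂ) ^ 2 * Complex.I_sq
    have hs : ‖(z.re : ℂ) + 2 * z.im * Complex.I‖ ≤ 3 * R := by
      refine (norm_add_le _ _).trans ?_
      simp only [norm_mul, Complex.norm_real, Complex.norm_I, Real.norm_eq_abs, hz]
      norm_num
      linarith
    rw [he, norm_div, norm_mul, norm_pow, Complex.norm_real, Complex.norm_real, Real.norm_eq_abs,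
      Real.norm_of_nonneg hR.le]
    calc |z.re| * ‖(z.re : ℂ) + 2 * z.im * Complex.I‖ / R ^ 2
        ≤ |z.re| * (3 * R) / R ^ 2 := by gcongr
      _ = 3 * (|z.re| / R) := by field_simp

/-- The kernel `e^{zx} (1 + z² / R²)^k`. -/
noncomputable def newmanKernel (x R : ℝ) (k : ℕ) (z : ℂ) : ℂ :=
  Complex.exp (z * x) * (1 + z ^ 2 / (R : ℂ) ^ 2) ^ k

theorem differentiable_newmanKernel (x R : ℝ) (k : ℕ) :
    Differentiable ℂ (newmanKernel x R k) := by
  unfold newmanKernel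
  fun_prop

theorem newmanKernel_zero (x R : ℝ) {k : ℕ} : newmanKernel x R k 0 = 1 := by
  simp [newmanKernel]

theorem norm_newmanKernel (x R : ℝ) (k : ℕ) (z : ℂ) :
    ‖newmanKernel x R k z‖ = Real.exp (z.re * x) * ‖1 + z ^ 2 / (R : ℂ) ^ 2‖ ^ k := by
  simp [newmanKernel, Complex.norm_exp]

theorem norm_mul_newmanKernel_div_le {f : ℂ → ℂ} {B x R : ℝ} {k : ℕ} (hk : k ≠ 0)
    (hR : 0 < R) {z : ℂ} (hre : |z.re| ≤ R) (him : |z.im| ≤ R) (hz : |z.re| = R ∨ |z.im| = R)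
    (hf : ‖f z‖ * |z.re| ≤ B * Real.exp (-z.re * x)) :
    ‖f z * newmanKernel x R k z / z‖ ≤ 3 ^ k * B / R ^ 2 := by
  have hRz : R ≤ ‖z‖ := by
    rcases hz with h | h
    · exact h ▸ Complex.abs_re_le_norm z
    · exact h ▸ Complex.abs_im_le_norm z
  have hq : (|z.re| / R) ^ k ≤ |z.re| / R :=
    pow_le_of_le_one (by positivity) ((div_le_one hR).2 hre) hk
  rw [norm_div, norm_mul, norm_newmanKernel]
  have hK : ‖1 + z ^ 2 / (R : ℂ) ^ 2‖ ^ k ≤ 3 ^ k * (|z.re| / R) := by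
    refine (pow_le_pow_left₀ (norm_nonneg _) (norm_one_add_sq_div_sq_le hR hre him hz) k).trans ?_
    rw [mul_pow]
    gcongr
  calc ‖f z‖ * (Real.exp (z.re * x) * ‖1 + z ^ 2 / (R : ℂ) ^ 2‖ ^ k) / ‖z‖
      ≤ ‖f z‖ * (Real.exp (z.re * x) * (3 ^ k * (|z.re| / R))) / R := by gcongr
    _ = (‖f z‖ * |z.re|) * (Real.exp (z.re * x) * 3 ^ k / R ^ 2) := by field_simp
    _ ≤ (B * Real.exp (-z.re * x)) * (Real.exp (z.re * x) * 3 ^ k / R ^ 2) := by gcongr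
    _ = 3 ^ k * B / R ^ 2 * (Real.exp (-z.re * x) * Real.exp (z.re * x)) := by ring
    _ = 3 ^ k * B / R ^ 2 := by rw [← Real.exp_add]; simp

/-- Newman's contour argument with free parameters `R` and `δ`. -/
theorem norm_sub_truncatedLaplace_zero_le {τ : ℝ → ℂ} (hmeas : Measurable τ) {B : ℝ}
    (hbdd : ∀ t : ℝ, 0 ≤ t → ‖τ t‖ ≤ B) {G : ℂ → ℂ} {U : Set ℂ} (hU : IsOpen U)
    (hG : DifferentiableOn ℂ G U)
    (hGL : ∀ s : ℂ, 0 < s.re → G s = ∫ t in Ioi (0:ℝ), τ t * Complex.exp (-(s * t)))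
    {M N x R δ : ℝ} (hM : 0 ≤ M) (hN : 0 ≤ N) (hx : 0 ≤ x) (hR : 1 ≤ R) (hδ : 0 < δ) (hδ1 : δ ≤ 1)
    (hsub : closedRect δ R R ⊆ U)
    (hbound : ∀ s ∈ closedRect δ R R, ‖G s‖ ≤ M * (1 + ‖s‖) ^ N)
    {k : ℕ} (hk : k ≠ 0) (hkN : N ≤ k) :
    2 * Real.pi * ‖G 0 - truncatedLaplace τ x 0‖
      ≤ 8 * 3 ^ k * B / R + 2 * (M * 3 ^ N * 3 ^ k) / R
        + 2 * (M * 3 ^ N * 3 ^ k) * (R ^ (N + 1) * Real.exp (-(δ * x)) / δ) := by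
  have hR0 : 0 < R := by linarith
  have hB : 0 ≤ B := (norm_nonneg _).trans (hbdd 0 le_rfl)
  set T := truncatedLaplace τ x with hT
  set P := newmanKernel x R k with hP
  have hPd : Differentiable ℂ P := differentiable_newmanKernel x R k
  have hTd : Differentiable ℂ T := differentiable_truncatedLaplace hmeas hbdd hx
  have hGP : DifferentiableOn ℂ (fun z => G z * P z) U := hG.mul hPd.differentiableOn
  have e1 := pathIntegral_div_self hδ hR0 hR0 hU hsub hGP
  have e2 := pathIntegral_div_self (g := fun z => T z * P z) hR0 hR0 hR0 isOpen_univ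
    (subset_univ _) (hTd.mul hPd).differentiableOn
  have hc1 : ContinuousOn (fun z => G z * P z / z) (closedRect δ R R \ {0}) :=
    (hGP.continuousOn.mono (sdiff_subset.trans hsub)).div continuousOn_id fun z hz => hz.2
  have hc2 : ContinuousOn (fun z => T z * P z / z) (closedRect δ R R \ {0}) :=
    (hTd.continuous.mul hPd.continuous).continuousOn.div continuousOn_id fun z hz => hz.2
  have e3 := rightPathIntegral_sub hδ.le hR0 hR0 hc1 hc2
  have hfun : (fun z => G z * P z / z - T z * P z / z) = fun z => (G z - T z) * P z / z := by
    funext z; ring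
  rw [hfun] at e3
  have hP0 : P 0 = 1 := newmanKernel_zero x R
  have hmain : 2 * Real.pi * Complex.I * (G 0 - T 0)
      = rightPathIntegral (fun z => (G z - T z) * P z / z) R R
        + leftPathIntegral (fun z => G z * P z / z) δ R
        - leftPathIntegral (fun z => T z * P z / z) R R := by
    simp only [hP0, mul_one] at e1 e2
    linear_combination e2 - e1 - e3
  have b1 : ‖rightPathIntegral (fun z => (G z - T z) * P z / z) R R‖
      ≤ 2 * R * (3 ^ k * B / R ^ 2) + 2 * R * (3 ^ k * B / R ^ 2) := by
    have hf : ∀ z : ℂ, 0 < z.re → ‖G z - T z‖ * |z.re| ≤ B * Real.exp (-z.re * x) := by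
      intro z hz
      rw [hGL z hz]
      exact norm_sub_truncatedLaplace_mul_le hmeas hbdd hx hz
    refine norm_rightPathIntegral_le hR0 hR0 (fun z h1 h2 h3 => ?_) (fun z h1 h2 => ?_)
    · exact norm_mul_newmanKernel_div_le (f := fun z => G z - T z) hk hR0
        (by rwa [abs_of_pos h1]) h3.le (.inr h3) (hf z h1)
    · have h3 : |z.re| = R := by rw [h1, abs_of_pos hR0]
      exact norm_mul_newmanKernel_div_le (f := fun z => G z - T z) hk hR0
        h3.le h2 (.inl h3) (hf z (by linarith))
  have b2 : ‖leftPathIntegral (fun z => T z * P z / z) R R‖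
      ≤ 2 * R * (3 ^ k * B / R ^ 2) + 2 * R * (3 ^ k * B / R ^ 2) := by
    refine norm_leftPathIntegral_le hR0 hR0 (fun z h1 h2 h3 => ?_) (fun z h1 h2 => ?_)
    · exact norm_mul_newmanKernel_div_le hk hR0 (abs_le.2 ⟨h1, by linarith⟩) h3.le (.inr h3)
        (norm_truncatedLaplace_mul_le hbdd hx h2)
    · have h3 : |z.re| = R := by rw [h1, abs_neg, abs_of_pos hR0]
      exact norm_mul_newmanKernel_div_le hk hR0 h3.le h2 (.inl h3)
        (norm_truncatedLaplace_mul_le hbdd hx (by linarith))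
  have hGb : ∀ z : ℂ, |z.re| ≤ δ → |z.im| ≤ R → ‖G z‖ ≤ M * 3 ^ N * R ^ N := by
    intro z h1 h2
    have h1' := abs_le.1 h1
    refine (hbound z (mem_closedRect.2 ⟨⟨h1'.1, by linarith⟩, abs_le.1 h2⟩)).trans ?_
    have h3 := Complex.norm_le_abs_re_add_abs_im z
    rw [mul_assoc, ← Real.mul_rpow (by norm_num) hR0.le]
    gcongr
    linarith
  have b3 : ‖leftPathIntegral (fun z => G z * P z / z) δ R‖
      ≤ 2 * δ * (M * 3 ^ N * 3 ^ k / R)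
        + 2 * R * (M * 3 ^ N * R ^ N * (Real.exp (-(δ * x)) * 3 ^ k) / δ) := by
    refine norm_leftPathIntegral_le hδ hR0 (fun z h1 h2 h3 => ?_) (fun z h1 h2 => ?_)
    · have hre : |z.re| ≤ δ := abs_le.2 ⟨h1, by linarith⟩
      have hRz : R ≤ ‖z‖ := h3 ▸ Complex.abs_im_le_norm z
      have hK : ‖1 + z ^ 2 / (R : ℂ) ^ 2‖ ^ k ≤ 3 ^ k / R ^ k := by
        rw [← div_pow (3 : ℝ)]
        refine pow_le_pow_left₀ (norm_nonneg _) ?_ k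
        refine (norm_one_add_sq_div_sq_le hR0 (by linarith) h3.le (.inr h3)).trans ?_
        rw [mul_div_assoc']
        gcongr
        linarith
      have hRN : R ^ N ≤ R ^ k := by
        rw [← Real.rpow_natCast]
        exact Real.rpow_le_rpow_of_exponent_le hR hkN
      have he : Real.exp (z.re * x) ≤ 1 :=
        Real.exp_le_one_iff.2 (mul_nonpos_of_nonpos_of_nonneg h2 hx)
      rw [norm_div, norm_mul, norm_newmanKernel]
      calc ‖G z‖ * (Real.exp (z.re * x) * ‖1 + z ^ 2 / (R : ℂ) ^ 2‖ ^ k) / ‖z‖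
          ≤ M * 3 ^ N * R ^ k * (1 * (3 ^ k / R ^ k)) / R := by
            have := (hGb z hre h3.le).trans
              (mul_le_mul_of_nonneg_left hRN (by positivity : 0 ≤ M * 3 ^ N))
            gcongr
        _ = M * 3 ^ N * 3 ^ k / R := by field_simp
    · have hre : |z.re| = δ := by rw [h1, abs_neg, abs_of_pos hδ]
      have hδz : δ ≤ ‖z‖ := hre ▸ Complex.abs_re_le_norm z
      have hK : ‖1 + z ^ 2 / (R : ℂ) ^ 2‖ ≤ 3 :=
        norm_one_add_sq_div_sq_le_three hR0 (by linarith) h2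
      rw [norm_div, norm_mul, norm_newmanKernel, h1, neg_mul]
      have := hGb z hre.le h2
      gcongr
  have hnorm : 2 * Real.pi * ‖G 0 - T 0‖ = ‖2 * Real.pi * Complex.I * (G 0 - T 0)‖ := by
    simp [abs_of_pos Real.pi_pos]
  rw [hnorm, hmain]
  refine (norm_sub_le _ _).trans ?_
  have h5 := norm_add_le (rightPathIntegral (fun z => (G z - T z) * P z / z) R R)
    (leftPathIntegral (fun z => G z * P z / z) δ R)
  have h1 : 2 * R * (3 ^ k * B / R ^ 2) = 2 * 3 ^ k * B / R := by field_simp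
  have h2 : 2 * R * (M * 3 ^ N * R ^ N * (Real.exp (-(δ * x)) * 3 ^ k) / δ)
      = 2 * (M * 3 ^ N * 3 ^ k) * (R ^ (N + 1) * Real.exp (-(δ * x)) / δ) := by
    rw [Real.rpow_add_one hR0.ne']; ring
  have h3 : 2 * δ * (M * 3 ^ N * 3 ^ k / R) ≤ 2 * (M * 3 ^ N * 3 ^ k) / R := by
    have : δ * (M * 3 ^ N * 3 ^ k / R) ≤ 1 * (M * 3 ^ N * 3 ^ k / R) := by gcongr
    rw [mul_div_assoc 2, mul_assoc]
    linarith
  have h4 : 8 * 3 ^ k * B / R = 4 * (2 * 3 ^ k * B / R) := by ring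
  rw [h1] at b1 b2
  rw [h2] at b3
  linarith

/-- Quantified Ingham–Karamata theorem: if the Laplace transform of a bounded
measurable function `τ` on `[0,∞)` extends holomorphically, with polynomial
bounds, to the region `Re s ≥ -C/(1+|Im s|)^κ`, then
`∫₀ˣ τ = G(0) + O((log x / x)^(1/κ))`. -/
theorem stmt_0 (κ C : ℝ) (hκ : 0 < κ) (hC : 0 < C)
    (τ : ℝ → ℂ) (hmeas : Measurable τ)
    (B : ℝ) (hbdd : ∀ t : ℝ, 0 ≤ t → ‖τ t‖ ≤ B)
    (G : ℂ → ℂ) (U : Set ℂ) (hUopen : IsOpen U)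
    (hΩU : {s : ℂ | -C / (1 + |s.im|) ^ κ ≤ s.re} ⊆ U)
    (hG : DifferentiableOn ℂ G U)
    (hGL : ∀ s : ℂ, 0 < s.re →
      G s = ∫ t in Ioi (0:ℝ), τ t * Complex.exp (-(s * t)))
    (M N : ℝ) (hM : 0 < M) (hN : 0 ≤ N)
    (hbound : ∀ s : ℂ, -C / (1 + |s.im|) ^ κ ≤ s.re →
      ‖G s‖ ≤ M * (1 + ‖s‖) ^ N) :
    ∃ K : ℝ, ∀ x : ℝ, 2 ≤ x →
      ‖(∫ t in (0:ℝ)..x, τ t) - G 0‖ ≤ K * (Real.log x / x) ^ (1/κ) := by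
  have hB : 0 ≤ B := (norm_nonneg _).trans (hbdd 0 le_rfl)
  obtain ⟨k, hkN⟩ := exists_nat_ge (N + 1)
  have hk : k ≠ 0 := by
    rintro rfl
    norm_num at hkN
    linarith
  have hlog2 : 0 < Real.log 2 := Real.log_pos (by norm_num)
  -- the left edge lies at `-c / R ^ κ`
  obtain ⟨c, hc0, hc1, hcC⟩ : ∃ c : ℝ, 0 < c ∧ c ≤ 1 ∧ c ≤ C / 2 ^ κ :=
    ⟨min 1 (C / 2 ^ κ), by positivity, min_le_left _ _, min_le_right _ _⟩
  set p : ℝ := (N + 1 + κ + 1) / κ with hp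
  have hp0 : 0 < p := by positivity
  set a : ℝ := c / p with ha
  have ha0 : 0 < a := by positivity
  set A : ℝ := M * 3 ^ N * 3 ^ k with hA
  have hA0 : 0 < A := by positivity
  set D : ℝ := 8 * 3 ^ k * B + 2 * A + 2 * A * ((a / Real.log 2) ^ p / c) with hD
  have hD0 : 0 ≤ D := by positivity
  set E : ℝ := B * (4 / a ^ 2) + ‖G 0‖ with hE
  have hE0 : 0 ≤ E := by positivity
  refine ⟨(D + E) * (a⁻¹) ^ (1 / κ), fun x hx => ?_⟩
  have hx0 : 0 < x := by linarith
  have hlx2 : Real.log 2 ≤ Real.log x := Real.log_le_log (by norm_num) hx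
  have hlx : 0 < Real.log x := by linarith
  set r : ℝ := a * x / Real.log x with hr
  have hr0 : 0 < r := by positivity
  have hinv : (a⁻¹) ^ (1 / κ) * (Real.log x / x) ^ (1 / κ) = (r ^ (1 / κ))⁻¹ := by
    rw [← Real.mul_rpow (by positivity) (by positivity), ← Real.inv_rpow hr0.le]
    congr 1
    rw [hr]
    field_simp
  rw [mul_assoc, hinv]
  rcases lt_or_ge r 1 with hr1 | hr1
  · -- `x` is bounded
    have h1 : 1 ≤ (r ^ (1 / κ))⁻¹ :=
      (one_le_inv₀ (by positivity)).2 (Real.rpow_le_one hr0.le hr1.le (by positivity))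
    have hax : a * x < Real.log x := (div_lt_one hlx).1 hr1
    have hsq : Real.log x ≤ 2 * √x := by
      have h2 := Real.log_le_sub_one_of_pos (Real.sqrt_pos.2 hx0)
      rw [Real.log_sqrt hx0.le] at h2
      linarith
    have hxb : x ≤ 4 / a ^ 2 := by
      have hs := Real.sq_sqrt hx0.le
      have hs0 := Real.sqrt_pos.2 hx0
      have h3 : a * √x ≤ 2 := by
        by_contra! h
        nlinarith
      rw [le_div_iff₀ (by positivity)]
      have h4 : (a * √x) ^ 2 ≤ 2 ^ 2 := pow_le_pow_left₀ (by positivity) h3 2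
      rw [mul_pow, hs] at h4
      linarith
    have hint : ‖∫ t in (0:ℝ)..x, τ t‖ ≤ B * |x - 0| := by
      refine intervalIntegral.norm_integral_le_of_norm_le_const fun t ht => ?_
      rw [uIoc_of_le hx0.le] at ht
      exact hbdd t ht.1.le
    rw [sub_zero, abs_of_pos hx0] at hint
    calc ‖(∫ t in (0:ℝ)..x, τ t) - G 0‖ ≤ B * x + ‖G 0‖ := by
          refine (norm_sub_le _ _).trans ?_
          gcongr
      _ ≤ E := by rw [hE]; gcongr
      _ ≤ (D + E) * 1 := by linarith
      _ ≤ (D + E) * (r ^ (1 / κ))⁻¹ := by gcongr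
  · set R : ℝ := r ^ (1 / κ) with hR
    have hR1 : 1 ≤ R := Real.one_le_rpow hr1 (by positivity)
    have hR0 : 0 < R := by linarith
    have hRκ : R ^ κ = r := by
      rw [hR, ← Real.rpow_mul hr0.le, one_div_mul_cancel hκ.ne', Real.rpow_one]
    set δ : ℝ := c / r with hδ
    have hδ0 : 0 < δ := by positivity
    have hδ1 : δ ≤ 1 := (div_le_one hr0).2 (by linarith)
    have hΩ : ∀ s ∈ closedRect δ R R, -C / (1 + |s.im|) ^ κ ≤ s.re := by
      intro s hs
      rw [mem_closedRect] at hs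
      refine le_trans ?_ hs.1.1
      rw [neg_div, neg_le_neg_iff]
      have him : |s.im| ≤ R := abs_le.2 hs.2
      have h1 : (1 + |s.im|) ^ κ ≤ 2 ^ κ * r := by
        rw [← hRκ, ← Real.mul_rpow (by norm_num) hR0.le]
        gcongr
        linarith
      calc δ ≤ C / 2 ^ κ / r := by rw [hδ]; gcongr
        _ = C / (2 ^ κ * r) := by rw [div_div]
        _ ≤ C / (1 + |s.im|) ^ κ := by gcongr
    have key := norm_sub_truncatedLaplace_zero_le hmeas hbdd hUopen hG hGL hM.le hN hx0.le hR1
      hδ0 hδ1 (fun s hs => hΩU (hΩ s hs)) (fun s hs => hbound s (hΩ s hs)) hk (by linarith)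
    have hexp : Real.exp (-(δ * x)) = x ^ (-p) := by
      rw [Real.rpow_def_of_pos hx0]
      congr 1
      rw [hδ, hr, ha]
      field_simp
    have hpow : R ^ (N + 1) / δ * R = r ^ p / c := by
      have h1 : r ^ p = R ^ (N + 1) * R * R ^ κ := by
        rw [hp, ← Real.rpow_add_one hR0.ne', ← Real.rpow_add hR0, hR, ← Real.rpow_mul hr0.le]
        congr 1
        ring
      rw [h1, hRκ, hδ]
      field_simp
    have htail : R ^ (N + 1) * Real.exp (-(δ * x)) / δ ≤ ((a / Real.log 2) ^ p / c) / R := by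
      rw [le_div_iff₀ hR0]
      calc R ^ (N + 1) * Real.exp (-(δ * x)) / δ * R
          = (R ^ (N + 1) / δ * R) * x ^ (-p) := by rw [hexp]; ring
        _ = (a / Real.log x) ^ p / c := by
          rw [hpow, Real.rpow_neg hx0.le, hr, mul_div_right_comm,
            Real.mul_rpow (by positivity) hx0.le]
          have : x ^ p ≠ 0 := (Real.rpow_pos_of_pos hx0 p).ne'
          field_simp
        _ ≤ (a / Real.log 2) ^ p / c := by gcongr
    have hT0 : truncatedLaplace τ x 0 = ∫ t in (0:ℝ)..x, τ t := by simp [truncatedLaplace]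
    rw [hT0, norm_sub_rev] at key
    have hpi : 1 ≤ 2 * Real.pi := by linarith [Real.two_le_pi]
    calc ‖(∫ t in (0:ℝ)..x, τ t) - G 0‖
        ≤ 2 * Real.pi * ‖(∫ t in (0:ℝ)..x, τ t) - G 0‖ :=
          le_mul_of_one_le_left (norm_nonneg _) hpi
      _ ≤ 8 * 3 ^ k * B / R + 2 * A / R + 2 * A * (((a / Real.log 2) ^ p / c) / R) := by
          refine key.trans ?_
          gcongr
      _ = D * R⁻¹ := by rw [hD]; ring
      _ ≤ (D + E) * R⁻¹ := by gcongr; linarith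
end

section
/- Let α > 1 be real and β ∈ ℂ with Re β > −1. The integral G_{α,β}(z) = exp(iπ(β+1)/(2α)) · ∫₀^∞ t^β exp(−t^α − i e^{iπ/(2α)} z t) dt converges absolutely for every z ∈ ℂ, and z ↦ G_{α,β}(z) is an entire function. Consequently F_{α,β}, which is holomorphic on the open lower half-plane {Im z < 0} and agrees there with G_{α,β}, admits an entire extension. -/
open MeasureTheory Set

/-- The rotated integral defining the entire extension of the
Fourier–Laplace transform `F_{α,β}`. -/
noncomputable def Gab (α : ℝ) (β : ℂ) (z : ℂ) : ℂ :=
  Complex.exp (Complex.I * Real.pi * (β + 1) / (2 * α)) *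
    ∫ t in Ioi (0:ℝ), (t : ℂ) ^ β *
      Complex.exp (-(↑(t ^ α) : ℂ) -
        Complex.I * Complex.exp (Complex.I * Real.pi / (2 * α)) * z * t)

/-- The Fourier–Laplace transform `F_{α,β}`, defined for `Im z < 0`. -/
noncomputable def Fab (α : ℝ) (β : ℂ) (z : ℂ) : ℂ :=
  ∫ t in Ioi (0:ℝ), (t : ℂ) ^ β *
    Complex.exp (Complex.I * (↑(t ^ α) : ℂ) - Complex.I * z * t)

open Filter Topology

theorem exp_image_univ : Real.exp '' univ = Ioi 0 := by
  rw [image_univ, Real.range_exp]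

/-- The substitution `t = exp s` in an integral over the positive half-line. -/
theorem integral_Ioi_eq_integral_exp_smul (f : ℝ → ℂ) :
    ∫ t in Ioi (0 : ℝ), f t = ∫ s : ℝ, Real.exp s • f (Real.exp s) := by
  rw [← exp_image_univ, integral_image_eq_integral_abs_deriv_smul MeasurableSet.univ
    (fun s _ => (Real.hasDerivAt_exp s).hasDerivWithinAt) Real.exp_injective.injOn]
  simp

theorem integrableOn_Ioi_iff_integrable_exp_smul (f : ℝ → ℝ) :
    IntegrableOn f (Ioi 0) ↔ Integrable (fun s : ℝ => Real.exp s • f (Real.exp s)) := by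
  rw [← exp_image_univ, integrableOn_image_iff_integrableOn_abs_deriv_smul MeasurableSet.univ
    (fun s _ => (Real.hasDerivAt_exp s).hasDerivWithinAt) Real.exp_injective.injOn]
  simp

/-- Shifting the line of integration of an entire function dominated in a horizontal strip. -/
theorem integral_eq_integral_add_mul_I {f : ℂ → ℂ} (hf : Differentiable ℂ f) {θ : ℝ}
    (hθ : 0 ≤ θ) {B : ℝ → ℝ} (hB : Integrable B) (hB_top : Tendsto B atTop (𝓝 0))
    (hB_bot : Tendsto B atBot (𝓝 0))
    (hfB : ∀ s : ℝ, ∀ y ∈ Icc 0 θ, ‖f (s + y * Complex.I)‖ ≤ B s) :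
    ∫ s : ℝ, f s = ∫ s : ℝ, f (s + θ * Complex.I) := by
  have hc : Continuous f := hf.continuous
  have hint (y : ℝ) (hy : y ∈ Icc 0 θ) : Integrable (fun s : ℝ => f (s + y * Complex.I)) :=
    hB.mono' (by fun_prop) (ae_of_all _ fun s => hfB s y hy)
  have hint₀ : Integrable (fun s : ℝ => f s) := by
    simpa using hint 0 ⟨le_rfl, hθ⟩
  have hvert (l : Filter ℝ) (g : ℝ → ℝ) (hg : Tendsto (fun T => B (g T)) l (𝓝 0)) :
      Tendsto (fun T => ∫ y : ℝ in (0 : ℝ)..θ, f (g T + y * Complex.I)) l (𝓝 0) := by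
    refine squeeze_zero_norm (a := fun T => B (g T) * |θ - 0|) (fun T => ?_)
      (by simpa using hg.mul_const |θ - 0|)
    refine intervalIntegral.norm_integral_le_of_norm_le_const fun y hy => hfB _ y ?_
    rw [uIoc_of_le hθ] at hy
    exact ⟨hy.1.le, hy.2⟩
  have hrect (T : ℝ) : (∫ s : ℝ in -T..T, f s) - (∫ s : ℝ in -T..T, f (s + θ * Complex.I)) +
      Complex.I * (∫ y : ℝ in (0 : ℝ)..θ, f (T + y * Complex.I)) -
      Complex.I * (∫ y : ℝ in (0 : ℝ)..θ, f ((-T : ℝ) + y * Complex.I)) = 0 := by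
    simpa using Complex.integral_boundary_rect_eq_zero_of_differentiableOn f (-T : ℝ)
      (T + θ * Complex.I) hf.differentiableOn
  have hlim := (((intervalIntegral_tendsto_integral hint₀ tendsto_neg_atTop_atBot tendsto_id).sub
    (intervalIntegral_tendsto_integral (hint θ ⟨hθ, le_rfl⟩) tendsto_neg_atTop_atBot
      tendsto_id)).add ((hvert atTop id hB_top).const_mul Complex.I)).sub
    ((hvert atTop (fun T => -T) (hB_bot.comp tendsto_neg_atTop_atBot)).const_mul Complex.I)
  simp only [id, hrect, mul_zero, add_zero, sub_zero] at hlim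
  exact sub_eq_zero.1 (tendsto_nhds_unique hlim tendsto_const_nhds)

theorem integrableOn_rpow_mul_exp_neg_mul {b δ : ℝ} (hb : -1 < b) (hδ : 0 < δ) :
    IntegrableOn (fun t : ℝ => t ^ b * Real.exp (-δ * t)) (Ioi 0) := by
  simpa using integrableOn_rpow_mul_exp_neg_mul_rpow hb one_pos hδ

theorem integrable_exp_mul_mul_exp_neg_mul_exp {b δ : ℝ} (hb : 0 < b) (hδ : 0 < δ) :
    Integrable (fun s : ℝ => Real.exp (b * s) * Real.exp (-δ * Real.exp s)) := by
  convert (integrableOn_Ioi_iff_integrable_exp_smul _).1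
    (integrableOn_rpow_mul_exp_neg_mul (b := b - 1) (by linarith) hδ) using 2 with s
  rw [smul_eq_mul, ← Real.exp_mul, ← mul_assoc, ← Real.exp_add s]
  congr 2
  ring

theorem tendsto_exp_mul_mul_exp_neg_mul_exp_atTop (b : ℝ) {δ : ℝ} (hδ : 0 < δ) :
    Tendsto (fun s : ℝ => Real.exp (b * s) * Real.exp (-δ * Real.exp s)) atTop (𝓝 0) := by
  convert (tendsto_rpow_mul_exp_neg_mul_atTop_nhds_zero b δ hδ).comp Real.tendsto_exp_atTop
    using 2 with s
  simp only [Function.comp_apply]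
  rw [← Real.exp_mul, mul_comm b]

theorem tendsto_exp_mul_mul_exp_neg_mul_exp_atBot {b : ℝ} (hb : 0 < b) (δ : ℝ) :
    Tendsto (fun s : ℝ => Real.exp (b * s) * Real.exp (-δ * Real.exp s)) atBot (𝓝 0) := by
  have h₁ : Tendsto (fun s : ℝ => Real.exp (b * s)) atBot (𝓝 0) :=
    Real.tendsto_exp_atBot.comp (tendsto_id.const_mul_atBot hb)
  have h₂ : Tendsto (fun s : ℝ => Real.exp (-δ * Real.exp s)) atBot (𝓝 (Real.exp (-δ * 0))) :=
    (Real.continuous_exp.tendsto _).comp (Real.tendsto_exp_atBot.const_mul (-δ))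
  simpa using h₁.mul h₂

/-- A linear function is dominated by `t ^ α` up to a constant, for `α > 1`. -/
theorem exists_mul_le_rpow_add {α : ℝ} (hα : 1 < α) {A : ℝ} (hA : 0 ≤ A) :
    ∃ M : ℝ, ∀ t : ℝ, 0 < t → A * t ≤ t ^ α + M := by
  refine ⟨A * A ^ (1 / (α - 1)), fun t ht => ?_⟩
  have hα' : 0 < α - 1 := by linarith
  rcases le_total t (A ^ (1 / (α - 1))) with h | h
  · have := mul_le_mul_of_nonneg_left h hA
    have := Real.rpow_nonneg ht.le α
    linarith
  · have hA' : A ≤ t ^ (α - 1) := by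
      have := Real.rpow_le_rpow (by positivity) h hα'.le
      rwa [← Real.rpow_mul hA, one_div_mul_cancel hα'.ne', Real.rpow_one] at this
    have h₁ : A * t ≤ t ^ α := by
      calc A * t ≤ t ^ (α - 1) * t := by gcongr
        _ = t ^ α := by rw [← Real.rpow_add_one ht.ne']; ring_nf
    have : 0 ≤ A * A ^ (1 / (α - 1)) := by positivity
    linarith

/-- Holomorphy of a Laplace-type integral under a locally uniform exponential bound. -/
theorem differentiableAt_integral_mul_exp {g : ℝ → ℂ} (hg : Measurable g) (c z₀ : ℂ)
    {ε K b δ : ℝ} (hε : 0 < ε) (hb : -1 < b) (hδ : 0 < δ)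
    (hbound : ∀ t : ℝ, 0 < t → ∀ z ∈ Metric.ball z₀ ε,
      ‖g t * Complex.exp (c * z * t)‖ ≤ K * (t ^ b * Real.exp (-δ * t))) :
    DifferentiableAt ℂ (fun z => ∫ t in Ioi (0 : ℝ), g t * Complex.exp (c * z * t)) z₀ := by
  have key := hasDerivAt_integral_of_dominated_loc_of_deriv_le (𝕜 := ℂ)
    (μ := volume.restrict (Ioi (0 : ℝ))) (x₀ := z₀)
    (F := fun z t => g t * Complex.exp (c * z * t))
    (F' := fun z t => g t * Complex.exp (c * z * t) * (c * t))
    (bound := fun t => ‖c‖ * K * (t ^ (b + 1) * Real.exp (-δ * t)))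
    (Metric.ball_mem_nhds z₀ hε) (.of_forall fun z => by fun_prop) ?_ (by fun_prop) ?_
    ((integrableOn_rpow_mul_exp_neg_mul (by linarith) hδ).const_mul _) ?_
  · exact key.2.differentiableAt
  · refine ((integrableOn_rpow_mul_exp_neg_mul hb hδ).const_mul K).mono' (by fun_prop) ?_
    filter_upwards [ae_restrict_mem measurableSet_Ioi] with t ht
    exact hbound t ht z₀ (Metric.mem_ball_self hε)
  · filter_upwards [ae_restrict_mem measurableSet_Ioi] with t (ht : 0 < t) z hz
    rw [norm_mul, norm_mul c, Complex.norm_real, Real.norm_of_nonneg ht.le,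
      Real.rpow_add_one ht.ne']
    calc _ ≤ K * (t ^ b * Real.exp (-δ * t)) * (‖c‖ * t) := by
          gcongr
          exact hbound t ht z hz
      _ = _ := by ring
  · refine ae_of_all _ fun t z _ => ?_
    have h := ((((hasDerivAt_id z).const_mul c).mul_const (t : ℂ)).cexp).const_mul (g t)
    simpa [mul_assoc] using h

/-- On a ball of parameters the rotated integrand is dominated by a Gamma-type integrand. -/
theorem exists_norm_cpow_mul_exp_neg_rpow_le {α : ℝ} (hα : 1 < α) (β c z₀ : ℂ) :
    ∃ K : ℝ, ∀ t : ℝ, 0 < t → ∀ z ∈ Metric.ball z₀ 1,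
      ‖(t : ℂ) ^ β * Complex.exp (-(↑(t ^ α) : ℂ)) * Complex.exp (c * z * t)‖ ≤
        K * (t ^ β.re * Real.exp (-1 * t)) := by
  obtain ⟨M, hM⟩ := exists_mul_le_rpow_add hα (A := ‖c‖ * (‖z₀‖ + 1) + 1) (by positivity)
  refine ⟨Real.exp M, fun t ht z hz => ?_⟩
  have hz' : ‖z‖ ≤ ‖z₀‖ + 1 := by
    have h₁ := norm_le_norm_add_norm_sub' z z₀
    have h₂ := mem_ball_iff_norm.1 hz
    linarith
  have hre : (c * z * t).re ≤ ‖c‖ * (‖z₀‖ + 1) * t := by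
    refine (Complex.re_le_norm _).trans ?_
    rw [norm_mul, norm_mul, Complex.norm_real, Real.norm_of_nonneg ht.le]
    gcongr
  rw [mul_assoc, norm_mul, Complex.norm_cpow_eq_rpow_re_of_pos ht, ← Complex.exp_add,
    Complex.norm_exp, mul_left_comm, ← Real.exp_add]
  gcongr
  rw [Complex.add_re, Complex.neg_re, Complex.ofReal_re]
  linarith [hM t ht]

/-- The integrand of `Fab` in the coordinate `w = log t`, an entire function of `w`. -/
noncomputable def logIntegrand (α : ℝ) (β z w : ℂ) : ℂ :=
  Complex.exp ((β + 1) * w + Complex.I * Complex.exp (α * w) - Complex.I * z * Complex.exp w)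

theorem differentiable_logIntegrand (α : ℝ) (β z : ℂ) :
    Differentiable ℂ (logIntegrand α β z) := by
  unfold logIntegrand
  fun_prop

theorem exp_smul_cpow_exp (β : ℂ) (s : ℝ) (x : ℂ) :
    Real.exp s • (((Real.exp s : ℝ) : ℂ) ^ β * x) = Complex.exp ((β + 1) * s) * x := by
  rw [Complex.cpow_def_of_ne_zero (by simp [Complex.exp_ne_zero]),
    ← Complex.ofReal_log (Real.exp_pos s).le, Real.log_exp, Complex.real_smul, Complex.ofReal_exp,
    ← mul_assoc, ← Complex.exp_add]
  ring_nf

theorem Fab_eq_integral_logIntegrand (α : ℝ) (β z : ℂ) :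
    Fab α β z = ∫ s : ℝ, logIntegrand α β z s := by
  rw [Fab, integral_Ioi_eq_integral_exp_smul]
  congr with s
  rw [exp_smul_cpow_exp, ← Complex.exp_add, logIntegrand, ← Real.exp_mul, mul_comm s α]
  push_cast
  ring_nf

theorem Gab_eq_integral_logIntegrand {α : ℝ} (hα : α ≠ 0) (β z : ℂ) :
    Gab α β z = ∫ s : ℝ, logIntegrand α β z (s + (Real.pi / (2 * α) : ℝ) * Complex.I) := by
  rw [Gab, integral_Ioi_eq_integral_exp_smul, ← integral_const_mul]
  congr with s
  have h : Complex.exp (α * (s + (Real.pi / (2 * α) : ℝ) * Complex.I)) =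
      Complex.exp (α * s) * Complex.I := by
    rw [mul_add, Complex.exp_add, ← mul_assoc (α : ℂ), ← Complex.ofReal_mul α (_ / _),
      show α * (Real.pi / (2 * α)) = Real.pi / 2 by field_simp, Complex.ofReal_div,
      Complex.ofReal_ofNat, Complex.exp_pi_div_two_mul_I]
  rw [exp_smul_cpow_exp, ← Complex.exp_add, ← Complex.exp_add, logIntegrand, h, Complex.exp_add s,
    ← Real.exp_mul, mul_comm s α,
    show Complex.I * Real.pi / (2 * α) = (Real.pi / (2 * α) : ℝ) * Complex.I by push_cast; ring]
  congr 1
  push_cast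
  linear_combination (-Complex.exp (α * s)) * Complex.I_sq

/-- Domination of `logIntegrand` in the strip between the two contours. -/
theorem exists_norm_logIntegrand_le {α : ℝ} (hα : 1 < α) (β : ℂ) {z : ℂ} (hz : z.im < 0) :
    ∃ K δ : ℝ, 0 < δ ∧ ∀ s : ℝ, ∀ y ∈ Icc 0 (Real.pi / (2 * α)),
      ‖logIntegrand α β z (s + y * Complex.I)‖ ≤
        K * (Real.exp ((β.re + 1) * s) * Real.exp (-δ * Real.exp s)) := by
  obtain ⟨M, hM⟩ := exists_mul_le_rpow_add hα (abs_nonneg z.re)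
  set θ := Real.pi / (2 * α) with hθ_def
  have hα₀ : 0 < α := by linarith
  have hθ : θ < Real.pi / 2 := by
    rw [hθ_def]
    gcongr
    linarith
  have hαθ : α * θ = Real.pi / 2 := by
    rw [hθ_def]
    field_simp
  have hθ₀ : 0 ≤ θ := by positivity
  have hcos : 0 < Real.cos θ := Real.cos_pos_of_mem_Ioo ⟨by linarith [Real.pi_pos], hθ⟩
  refine ⟨Real.exp (|β.im| * θ + |M|), -z.im * Real.cos θ, by nlinarith, fun s y hy => ?_⟩
  have hαy : α * y ≤ Real.pi / 2 := hαθ ▸ mul_le_mul_of_nonneg_left hy.2 hα₀.le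
  have hcosy : Real.cos θ ≤ Real.cos y :=
    Real.cos_le_cos_of_nonneg_of_le_pi hy.1 (by linarith [Real.pi_pos]) hy.2
  have hsiny : 0 ≤ Real.sin y :=
    Real.sin_nonneg_of_nonneg_of_le_pi hy.1 (by linarith [Real.pi_pos, hy.2])
  have hsin : Real.sin y ≤ Real.sin (α * y) :=
    Real.sin_le_sin_of_le_of_le_pi_div_two (by linarith [Real.pi_pos, hy.1]) hαy
      (le_mul_of_one_le_left hy.1 hα.le)
  have hM' := hM _ (Real.exp_pos s)
  rw [← Real.exp_mul, mul_comm s α] at hM'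
  have h₁ : -(β.im * y) ≤ |β.im| * θ := by
    have := mul_le_mul (neg_le_abs β.im) hy.2 hy.1 (abs_nonneg _)
    linarith
  have h₂ : Real.exp s * (z.re * Real.sin y) - Real.exp (α * s) * Real.sin (α * y) ≤ |M| := by
    calc _ ≤ Real.exp s * (|z.re| * Real.sin y) - Real.exp (α * s) * Real.sin y := by
          gcongr
          exact le_abs_self _
      _ = (|z.re| * Real.exp s - Real.exp (α * s)) * Real.sin y := by ring
      _ ≤ |M| * Real.sin y := by
          gcongr
          linarith [le_abs_self M]
      _ ≤ |M| := mul_le_of_le_one_right (abs_nonneg M) (Real.sin_le_one y)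
  have h₃ : Real.exp s * (z.im * Real.cos y) ≤ z.im * Real.cos θ * Real.exp s := by
    have := mul_le_mul_of_nonpos_left hcosy hz.le
    nlinarith [Real.exp_pos s]
  have hre : ((β + 1) * (s + y * Complex.I) + Complex.I * Complex.exp (α * (s + y * Complex.I)) -
      Complex.I * z * Complex.exp (s + y * Complex.I)).re =
      (β.re + 1) * s - β.im * y - Real.exp (α * s) * Real.sin (α * y) +
        Real.exp s * (z.im * Real.cos y) + Real.exp s * (z.re * Real.sin y) := by
    simp [Complex.exp_re, Complex.exp_im]
    ring
  rw [logIntegrand, Complex.norm_exp, hre, ← Real.exp_add, ← Real.exp_add]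
  exact Real.exp_le_exp.2 (by linarith)

/-- The integral defining `G_{α,β}` converges absolutely for every `z ∈ ℂ`,
`G_{α,β}` is an entire function, and `F_{α,β}` is holomorphic on the open
lower half-plane and agrees there with `G_{α,β}`: thus `F_{α,β}` admits an
entire extension. -/
theorem stmt_2 (α : ℝ) (hα : 1 < α) (β : ℂ) (hβ : -1 < β.re) :
    (∀ z : ℂ, IntegrableOn (fun t : ℝ => (t : ℂ) ^ β *
      Complex.exp (-(↑(t ^ α) : ℂ) -
        Complex.I * Complex.exp (Complex.I * Real.pi / (2 * α)) * z * t)) (Ioi 0)) ∧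
    Differentiable ℂ (Gab α β) ∧
    DifferentiableOn ℂ (Fab α β) {z : ℂ | z.im < 0} ∧
    ∀ z : ℂ, z.im < 0 → Gab α β z = Fab α β z := by
  set c : ℂ := -(Complex.I * Complex.exp (Complex.I * Real.pi / (2 * α))) with hc
  have hrw (z : ℂ) (t : ℝ) : (t : ℂ) ^ β * Complex.exp (-(↑(t ^ α) : ℂ) -
      Complex.I * Complex.exp (Complex.I * Real.pi / (2 * α)) * z * t) =
      (t : ℂ) ^ β * Complex.exp (-(↑(t ^ α) : ℂ)) * Complex.exp (c * z * t) := by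
    rw [mul_assoc (_ ^ β), ← Complex.exp_add, hc]
    ring_nf
  have hmeas : Measurable (fun t : ℝ => (t : ℂ) ^ β * Complex.exp (-(↑(t ^ α) : ℂ))) := by
    fun_prop
  have hG : Differentiable ℂ (Gab α β) := by
    intro z₀
    obtain ⟨K, hK⟩ := exists_norm_cpow_mul_exp_neg_rpow_le hα β c z₀
    unfold Gab
    simp_rw [hrw]
    exact (differentiableAt_integral_mul_exp hmeas c z₀ one_pos hβ one_pos hK).const_mul _
  have hGF (z : ℂ) (hz : z.im < 0) : Gab α β z = Fab α β z := by
    obtain ⟨K, δ, hδ, hK⟩ := exists_norm_logIntegrand_le hα β hz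
    have hb : 0 < β.re + 1 := by linarith
    rw [Gab_eq_integral_logIntegrand (by linarith), Fab_eq_integral_logIntegrand]
    exact (integral_eq_integral_add_mul_I (differentiable_logIntegrand α β z) (by positivity)
      ((integrable_exp_mul_mul_exp_neg_mul_exp hb hδ).const_mul K)
      (by simpa using (tendsto_exp_mul_mul_exp_neg_mul_exp_atTop (β.re + 1) hδ).const_mul K)
      (by simpa using (tendsto_exp_mul_mul_exp_neg_mul_exp_atBot hb δ).const_mul K) hK).symm
  refine ⟨fun z => ?_, hG, hG.differentiableOn.congr fun z hz => (hGF z hz).symm, hGF⟩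
  obtain ⟨K, hK⟩ := exists_norm_cpow_mul_exp_neg_rpow_le hα β c z
  simp_rw [hrw]
  refine ((integrableOn_rpow_mul_exp_neg_mul hβ one_pos).const_mul K).mono' (by fun_prop) ?_
  filter_upwards [ae_restrict_mem measurableSet_Ioi] with t ht
  exact hK t ht z (Metric.mem_ball_self one_pos)
end

section
/- Let α > 1 be real and β ∈ ℂ with Re β > −1. For θ ∈ (0, π − π/α) set η₁(θ) = π/4 − (α − 2β − 2)θ/(2(α−1)), η₂(θ) = αθ/(α−1) − π/2, and M(R,θ) = exp(i η₁(θ)) · √(2π/(α−1)) · α^{(−1/2−β)/(α−1)} · R^{(β+1−α/2)/(α−1)} · exp( e^{i η₂(θ)} α^{−1/(α−1)} (1 − 1/α) R^{α/(α−1)} ). Then for every ε > 0, sup over θ ∈ [ε, π − π/α − ε] of |G_{α,β}(R e^{iθ})/M(R,θ) − 1| tends to 0 as R → ∞. In particular, for each fixed such θ, G_{α,β}(R e^{iθ}) ∼ M(R,θ) as R → ∞. -/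
open MeasureTheory Set Filter

/-- The leading asymptotic term `M(R,θ)` of `G_{α,β}(R e^{iθ})` in the
sector `0 < θ < π − π/α`, with `η₁(θ) = π/4 − (α−2β−2)θ/(2(α−1))` and
`η₂(θ) = αθ/(α−1) − π/2`. -/
noncomputable def Masym (α : ℝ) (β : ℂ) (R θ : ℝ) : ℂ :=
  Complex.exp (Complex.I *
      ((Real.pi : ℂ) / 4 - ((α : ℂ) - 2 * β - 2) * (θ : ℂ) / (2 * ((α : ℂ) - 1)))) *
    (Real.sqrt (2 * Real.pi / (α - 1)) : ℂ) *
    (α : ℂ) ^ ((-1/2 - β) / ((α : ℂ) - 1)) *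
    (R : ℂ) ^ ((β + 1 - (α : ℂ) / 2) / ((α : ℂ) - 1)) *
    Complex.exp (Complex.exp (Complex.I * ((α * θ / (α - 1) : ℝ) - (Real.pi : ℂ) / 2)) *
      (↑(α ^ (-1 / (α - 1)) : ℝ) : ℂ) * (1 - 1 / (α : ℂ)) * (↑(R ^ (α / (α - 1)) : ℝ) : ℂ))

/-- The shape of the exponent in logarithmic coordinates centred at the saddle point. -/
noncomputable def saddlePhase (α x : ℝ) : ℝ :=
  Real.exp (α * x) - α * Real.exp x + (α - 1)

theorem hasDerivAt_saddlePhase (α x : ℝ) :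
    HasDerivAt (saddlePhase α) (α * (Real.exp (α * x) - Real.exp x)) x := by
  have h1 : HasDerivAt (fun x => Real.exp (α * x)) (Real.exp (α * x) * (α * 1)) x :=
    ((hasDerivAt_id x).const_mul α).exp
  have h2 := ((h1.sub ((Real.hasDerivAt_exp x).const_mul α)).add_const (α - 1))
  exact h2.congr_deriv (by ring)

theorem continuous_saddlePhase (α : ℝ) : Continuous (saddlePhase α) :=
  continuous_iff_continuousAt.2 fun x => (hasDerivAt_saddlePhase α x).continuousAt

theorem saddlePhase_zero (α : ℝ) : saddlePhase α 0 = 0 := by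
  simp [saddlePhase]

theorem quadratic_le_saddlePhase {α : ℝ} (hα : 1 < α) {x : ℝ} (hx : 0 ≤ x) :
    α * (α - 1) / 2 * x ^ 2 ≤ saddlePhase α x := by
  have hd : ∀ y : ℝ, HasDerivAt (fun y => saddlePhase α y - α * (α - 1) / 2 * y ^ 2)
      (α * (Real.exp (α * y) - Real.exp y) - α * (α - 1) * y) y := by
    intro y
    refine ((hasDerivAt_saddlePhase α y).sub
      ((hasDerivAt_pow 2 y).const_mul (α * (α - 1) / 2))).congr_deriv ?_
    push_cast
    ring
  have hm : MonotoneOn (fun y => saddlePhase α y - α * (α - 1) / 2 * y ^ 2) (Ici 0) := by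
    apply monotoneOn_of_deriv_nonneg (convex_Ici 0)
    · exact fun y _ => (hd y).continuousAt.continuousWithinAt
    · exact fun y _ => (hd y).differentiableAt.differentiableWithinAt
    · intro y hy
      rw [interior_Ici] at hy
      have hy : 0 < y := hy
      rw [(hd y).deriv]
      have e : Real.exp (α * y) = Real.exp y * Real.exp ((α - 1) * y) := by
        rw [← Real.exp_add]; ring_nf
      have h1 := Real.add_one_le_exp ((α - 1) * y)
      have h2 := Real.one_le_exp hy.le
      have h3 : 0 ≤ (α - 1) * y := mul_nonneg (by linarith) hy.le
      have : (α - 1) * y ≤ Real.exp (α * y) - Real.exp y := by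
        rw [e]; nlinarith
      nlinarith
  have := hm (mem_Ici.2 le_rfl) (mem_Ici.2 hx) hx
  simp only [saddlePhase_zero] at this
  linarith

theorem exists_quadratic_le_saddlePhase {α : ℝ} (hα : 1 < α) :
    ∃ m : ℝ, 0 < m ∧ ∀ x, m * (x ^ 2 / (1 + x ^ 2)) ≤ saddlePhase α x := by
  set k := α * (Real.exp (-1) * (1 - Real.exp (-(α - 1)))) with hk
  have hk1 : Real.exp (-(α - 1)) < 1 := by
    rw [Real.exp_lt_one_iff]; linarith
  have hkpos : 0 < k := by
    have := Real.exp_pos (-1)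
    have : 0 < 1 - Real.exp (-(α - 1)) := by linarith
    positivity
  have hanti : AntitoneOn (saddlePhase α) (Iic 0) := by
    apply antitoneOn_of_deriv_nonpos (convex_Iic 0)
    · exact (continuous_saddlePhase α).continuousOn
    · exact fun y _ => (hasDerivAt_saddlePhase α y).differentiableAt.differentiableWithinAt
    · intro y hy
      rw [interior_Iic] at hy
      have hy : y < 0 := hy
      rw [(hasDerivAt_saddlePhase α y).deriv]
      have : Real.exp (α * y) ≤ Real.exp y := Real.exp_le_exp.2 (by nlinarith)
      nlinarith
  have hd : ∀ y : ℝ, HasDerivAt (fun y => saddlePhase α y - k / 2 * y ^ 2)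
      (α * (Real.exp (α * y) - Real.exp y) - k * y) y := by
    intro y
    refine ((hasDerivAt_saddlePhase α y).sub
      ((hasDerivAt_pow 2 y).const_mul (k / 2))).congr_deriv ?_
    push_cast
    ring
  have hanti' : AntitoneOn (fun y => saddlePhase α y - k / 2 * y ^ 2) (Icc (-1) 0) := by
    apply antitoneOn_of_deriv_nonpos (convex_Icc _ _)
    · exact fun y _ => (hd y).continuousAt.continuousWithinAt
    · exact fun y _ => (hd y).differentiableAt.differentiableWithinAt
    · intro y hy
      rw [interior_Icc] at hy
      obtain ⟨hy1, hy0⟩ := hy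
      rw [(hd y).deriv]
      have e : Real.exp (α * y) = Real.exp y * Real.exp ((α - 1) * y) := by
        rw [← Real.exp_add]; ring_nf
      have hc : Real.exp ((α - 1) * y) ≤ 1 + y * (1 - Real.exp (-(α - 1))) := by
        have := convexOn_exp.2 (mem_univ (0 : ℝ)) (mem_univ (-(α - 1)))
          (show 0 ≤ 1 + y by linarith) (show 0 ≤ -y by linarith) (by ring)
        simp only [smul_eq_mul, Real.exp_zero] at this
        have e2 : (1 + y) * 0 + -y * -(α - 1) = (α - 1) * y := by ring
        rw [e2] at this
        linarith
      have he : Real.exp (-1) ≤ Real.exp y := Real.exp_le_exp.2 hy1.le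
      have hy' : 0 ≤ (-y) * (1 - Real.exp (-(α - 1))) :=
        mul_nonneg (by linarith) (by linarith)
      have : Real.exp (α * y) - Real.exp y ≤ Real.exp (-1) * (y * (1 - Real.exp (-(α - 1)))) := by
        rw [e]
        nlinarith [Real.exp_pos y]
      have := mul_le_mul_of_nonneg_left this (show 0 ≤ α by linarith)
      rw [hk]
      linarith
  refine ⟨min (k / 2) (α * (α - 1) / 2), lt_min (by positivity) (by nlinarith), fun x => ?_⟩
  have hq1 : x ^ 2 / (1 + x ^ 2) ≤ x ^ 2 := div_le_self (by positivity) (by nlinarith)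
  have hq2 : x ^ 2 / (1 + x ^ 2) ≤ 1 := (div_le_one (by positivity)).2 (by linarith)
  have hq0 : 0 ≤ x ^ 2 / (1 + x ^ 2) := by positivity
  have hl := min_le_left (k / 2) (α * (α - 1) / 2)
  have hr := min_le_right (k / 2) (α * (α - 1) / 2)
  rcases le_total 0 x with hx | hx
  · refine le_trans ?_ (quadratic_le_saddlePhase hα hx)
    exact mul_le_mul hr hq1 hq0 (by nlinarith)
  · have key : ∀ y ∈ Icc (-1 : ℝ) 0, k / 2 * y ^ 2 ≤ saddlePhase α y := by
      intro y hy
      have := hanti' hy (right_mem_Icc.2 (by norm_num)) hy.2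
      simp only [saddlePhase_zero] at this
      linarith
    rcases le_total (-1) x with h1 | h1
    · exact (mul_le_mul hl hq1 hq0 (by positivity)).trans (key x ⟨h1, hx⟩)
    · have h2 := hanti (show x ∈ Iic 0 from hx) (show (-1 : ℝ) ∈ Iic 0 by simp) h1
      have h3 := key (-1) (by simp)
      have h4 := mul_le_mul hl hq2 hq0 (by positivity)
      linarith

theorem saddlePhase_nonneg {α : ℝ} (hα : 1 < α) (x : ℝ) : 0 ≤ saddlePhase α x := by
  obtain ⟨m, hm, h⟩ := exists_quadratic_le_saddlePhase hα
  exact le_trans (by positivity) (h x)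

theorem one_add_sq_mul_exp_neg_le {b : ℝ} (hb : 0 < b) {x : ℝ} (hx : 0 ≤ x) :
    (1 + x ^ 2) * Real.exp (-(b * x)) ≤ 1 + 2 / b ^ 2 := by
  have h := Real.quadratic_le_exp_of_nonneg (mul_nonneg hb.le hx)
  have hbx := mul_nonneg hb.le hx
  rw [Real.exp_neg, ← div_eq_mul_inv, div_le_iff₀ (Real.exp_pos _)]
  have h1 : (1 + x ^ 2) ≤ (1 + 2 / b ^ 2) * (1 + b * x + (b * x) ^ 2 / 2) := by
    have : (1 + 2 / b ^ 2) * (1 + b * x + (b * x) ^ 2 / 2) =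
      1 + x ^ 2 + (b * x + (b * x) ^ 2 / 2 + 2 / b ^ 2 * (1 + b * x)) := by
      field_simp; ring
    rw [this]
    have : 0 ≤ b * x + (b * x) ^ 2 / 2 + 2 / b ^ 2 * (1 + b * x) := by positivity
    linarith
  exact h1.trans (mul_le_mul_of_nonneg_left h (by positivity))

theorem exists_exp_sub_saddlePhase_le {α : ℝ} (hα : 1 < α) {b c : ℝ} (hb : 0 < b) (hc : 0 < c) :
    ∃ C : ℝ, 0 < C ∧ ∀ x, Real.exp (b * x - c * saddlePhase α x) ≤ C / (1 + x ^ 2) := by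
  have hK : 0 < c * (α * (α - 1) / 2) := by
    have : 0 < α - 1 := by linarith
    positivity
  set K := c * (α * (α - 1) / 2) with hKd
  refine ⟨max (1 + 2 / b ^ 2) (Real.exp ((2 * b) ^ 2 / (4 * K)) * (1 + 2 / b ^ 2)),
    lt_max_of_lt_left (by positivity), fun x => ?_⟩
  rw [le_div_iff₀ (by positivity)]
  rcases le_total x 0 with hx | hx
  · refine le_trans ?_ (le_max_left _ _)
    have h := one_add_sq_mul_exp_neg_le hb (show 0 ≤ -x by linarith)
    have h2 : Real.exp (b * x - c * saddlePhase α x) ≤ Real.exp (-(b * -x)) :=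
      Real.exp_le_exp.2 (by nlinarith [mul_nonneg hc.le (saddlePhase_nonneg hα x)])
    rw [neg_sq] at h
    nlinarith [sq_nonneg x]
  · refine le_trans ?_ (le_max_right _ _)
    have h := one_add_sq_mul_exp_neg_le hb hx
    have h2 : Real.exp (b * x - c * saddlePhase α x) ≤
        Real.exp ((2 * b) ^ 2 / (4 * K)) * Real.exp (-(b * x)) := by
      rw [← Real.exp_add, Real.exp_le_exp]
      have h3 := mul_le_mul_of_nonneg_left (quadratic_le_saddlePhase hα hx) hc.le
      have h4 : (2 * b) ^ 2 / (4 * K) - 2 * b * x + K * x ^ 2 = K * (x - b / K) ^ 2 := by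
        field_simp; ring
      have h5 : 0 ≤ K * (x - b / K) ^ 2 := by positivity
      have h6 : K * x ^ 2 = c * (α * (α - 1) / 2 * x ^ 2) := by rw [hKd]; ring
      linarith
    calc _ ≤ Real.exp ((2 * b) ^ 2 / (4 * K)) * Real.exp (-(b * x)) * (1 + x ^ 2) := by gcongr
      _ = Real.exp ((2 * b) ^ 2 / (4 * K)) * ((1 + x ^ 2) * Real.exp (-(b * x))) := by ring
      _ ≤ _ := by gcongr

theorem exists_exp_sub_mul_saddlePhase_le {α : ℝ} (hα : 1 < α) {b c : ℝ} (hb : 0 < b)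
    (hc : 0 < c) : ∃ C k : ℝ, 0 < C ∧ 0 < k ∧ ∀ r, 2 ≤ r → ∀ x,
      Real.exp (b * x - c * r * saddlePhase α x) ≤ C / (1 + k * (r * x ^ 2)) := by
  obtain ⟨C, hC, h⟩ := exists_exp_sub_saddlePhase_le hα hb hc
  obtain ⟨m, hm, hq⟩ := exists_quadratic_le_saddlePhase hα
  refine ⟨C, c * m / 2, hC, by positivity, fun r hr x => ?_⟩
  have e : Real.exp (b * x - c * r * saddlePhase α x) ≤
      Real.exp (b * x - c * saddlePhase α x) * Real.exp (-(c * r / 2 * saddlePhase α x)) := by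
    rw [← Real.exp_add, Real.exp_le_exp]
    nlinarith [mul_nonneg (mul_nonneg hc.le (show 0 ≤ r - 2 by linarith)) (saddlePhase_nonneg hα x)]
  refine e.trans ?_
  have hrpos : 0 < r := by linarith
  have h1 : Real.exp (-(c * r / 2 * saddlePhase α x)) ≤
      (1 + c * r / 2 * (m * (x ^ 2 / (1 + x ^ 2))))⁻¹ := by
    rw [Real.exp_neg]
    apply inv_anti₀ (by positivity)
    have := Real.add_one_le_exp (c * r / 2 * saddlePhase α x)
    have h2 := mul_le_mul_of_nonneg_left (hq x) (show 0 ≤ c * r / 2 by positivity)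
    linarith
  calc _ ≤ C / (1 + x ^ 2) * (1 + c * r / 2 * (m * (x ^ 2 / (1 + x ^ 2))))⁻¹ := by
        gcongr
        exact h x
    _ = C / (1 + x ^ 2 + c * m / 2 * (r * x ^ 2)) := by
        field_simp
    _ ≤ _ := by gcongr; nlinarith [sq_nonneg x]

/-- Shifting the contour of integration from the real line to a parallel line. -/
theorem integral_add_mul_I_eq {f : ℂ → ℂ} (hf : Differentiable ℂ f) {C ψ : ℝ}
    (hbd : ∀ x : ℝ, ∀ y ∈ uIcc 0 ψ, ‖f (x + y * Complex.I)‖ ≤ C / (1 + x ^ 2)) :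
    ∫ x : ℝ, f (x + ψ * Complex.I) = ∫ x : ℝ, f x := by
  have hintegral : ∀ y ∈ uIcc 0 ψ, Integrable (fun x : ℝ => f (x + y * Complex.I)) := by
    intro y hy
    refine (integrable_inv_one_add_sq.const_mul C).mono' ?_ (ae_of_all _ fun x => ?_)
    · exact (hf.continuous.comp (by fun_prop)).aestronglyMeasurable
    · simpa [div_eq_mul_inv] using hbd x y hy
  have hz : Tendsto (fun T : ℝ => C / (1 + T ^ 2) * |ψ - 0|) atTop (nhds 0) := by
    have h : Tendsto (fun T : ℝ => 1 + T ^ 2) atTop atTop :=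
      tendsto_atTop_add_const_left _ _ (tendsto_pow_atTop two_ne_zero)
    simpa using (h.const_div_atTop C).mul_const |ψ - 0|
  have hv : ∀ g : ℝ → ℝ, (∀ T, g T ^ 2 = T ^ 2) → Tendsto (fun T : ℝ =>
      ∫ y : ℝ in 0..ψ, f ((g T : ℝ) + y * Complex.I)) atTop (nhds 0) := by
    intro g hg
    refine squeeze_zero_norm (fun T => ?_) hz
    apply intervalIntegral.norm_integral_le_of_norm_le_const
    intro y hy
    rw [← hg T]
    exact hbd _ y (uIoc_subset_uIcc hy)
  have h0 := intervalIntegral_tendsto_integral (hintegral 0 left_mem_uIcc)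
    tendsto_neg_atTop_atBot tendsto_id
  have h1 := intervalIntegral_tendsto_integral (hintegral ψ right_mem_uIcc)
    tendsto_neg_atTop_atBot tendsto_id
  have hr := (((h0.sub h1).add ((hv id fun _ => rfl).const_smul Complex.I)).sub
    ((hv Neg.neg fun T => neg_sq T).const_smul Complex.I))
  have hzero : Tendsto (fun _ : ℝ => (0 : ℂ)) atTop (nhds 0) := tendsto_const_nhds
  have := tendsto_nhds_unique hr (hzero.congr fun T => ?_)
  · simp only [Complex.ofReal_zero, zero_mul, add_zero, smul_zero, sub_zero] at this
    exact (sub_eq_zero.1 this).symm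
  · have := Complex.integral_boundary_rect_eq_zero_of_differentiableOn f
      ((-T : ℝ)) (T + ψ * Complex.I) hf.differentiableOn
    simp at this
    simp [this]

theorem saddlePhase_sub_isLittleO (α : ℝ) :
    (fun x => saddlePhase α x - α * (α - 1) / 2 * x ^ 2) =o[nhds 0] fun x : ℝ => x ^ 2 := by
  have h1 := Real.exp_sub_sum_range_succ_isLittleO_pow 2
  have ht : Tendsto (fun x : ℝ => α * x) (nhds 0) (nhds 0) := by
    simpa using (continuous_const_mul α).tendsto 0
  have h2 := h1.comp_tendsto ht
  have h3 : (fun x : ℝ => (α * x) ^ 2) =O[nhds 0] fun x : ℝ => x ^ 2 := by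
    simp_rw [mul_pow]
    exact Asymptotics.isBigO_const_mul_self _ _ _
  refine ((h2.trans_isBigO h3).sub (h1.const_mul_left α)).congr_left fun x => ?_
  simp [Finset.sum_range_succ, saddlePhase]
  ring

theorem tendsto_mul_saddlePhase_div_sqrt (α y : ℝ) :
    Tendsto (fun r : ℝ => r * saddlePhase α (y / √r)) atTop
      (nhds (α * (α - 1) / 2 * y ^ 2)) := by
  have ht : Tendsto (fun r : ℝ => y / √r) atTop (nhds 0) :=
    Real.tendsto_sqrt_atTop.const_div_atTop y
  have h1 := (Asymptotics.isBigO_refl (fun r : ℝ => r) atTop).mul_isLittleO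
    ((saddlePhase_sub_isLittleO α).comp_tendsto ht)
  have h2 : (fun r : ℝ => r * (y / √r) ^ 2) =ᶠ[atTop] fun _ => y ^ 2 := by
    filter_upwards [eventually_gt_atTop 0] with r hr
    rw [div_pow, Real.sq_sqrt hr.le]
    field_simp
  have h3 := (h1.trans_eventuallyEq h2).trans_isBigO
    (Asymptotics.isBigO_const_const (y ^ 2) (one_ne_zero (α := ℝ)) atTop)
  rw [Asymptotics.isLittleO_one_iff] at h3
  have h4 := h3.add_const (α * (α - 1) / 2 * y ^ 2)
  rw [zero_add] at h4
  refine h4.congr' ?_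
  filter_upwards [h2] with r hr
  simp only [Function.comp]
  linear_combination (-(α * (α - 1) / 2)) * hr

theorem norm_cexp_saddle_le {α : ℝ} (hα : 1 < α) (β : ℂ) {c r x : ℝ} {ω : ℂ} (hr : 0 ≤ r)
    (hω : c ≤ ω.re) :
    ‖Complex.exp ((β + 1) * x - r * ω * saddlePhase α x)‖ ≤
      Real.exp ((β.re + 1) * x - c * r * saddlePhase α x) := by
  rw [Complex.norm_exp, Real.exp_le_exp]
  have h1 : ((β + 1) * x - r * ω * saddlePhase α x : ℂ).re =
      (β.re + 1) * x - ω.re * (r * saddlePhase α x) := by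
    simp; ring
  rw [h1]
  nlinarith [mul_le_mul_of_nonneg_right hω (mul_nonneg hr (saddlePhase_nonneg hα x))]

/-- Laplace's method at the saddle point, uniformly over phases in a closed subsector of the
right half-plane. -/
theorem tendsto_integral_saddle_sub {α : ℝ} (hα : 1 < α) {β : ℂ} (hβ : -1 < β.re) {c : ℝ}
    (hc : 0 < c) :
    Tendsto (fun p : ℝ × ℂ =>
      (∫ y : ℝ, Complex.exp ((β + 1) * (y / √p.1 : ℝ) - p.1 * p.2 * saddlePhase α (y / √p.1))) -
        (Real.pi / (α * (α - 1) / 2 * p.2)) ^ (1 / 2 : ℂ))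
      (atTop ×ˢ 𝓟 {ω : ℂ | ‖ω‖ = 1 ∧ c ≤ ω.re}) (nhds 0) := by
  set S : Set ℂ := {ω : ℂ | ‖ω‖ = 1 ∧ c ≤ ω.re} with hS
  have hκ : 0 < α * (α - 1) / 2 := by
    have : 0 < α - 1 := by linarith
    positivity
  set κ := α * (α - 1) / 2 with hκd
  have hκc : (α * (α - 1) / 2 : ℂ) = κ := by rw [hκd]; push_cast; rfl
  rw [hκc]
  obtain ⟨C, k, hC, hk, hdom⟩ :=
    exists_exp_sub_mul_saddlePhase_le hα (show 0 < β.re + 1 by linarith) hc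
  let A : ℝ × ℂ → ℝ → ℂ := fun p y =>
    Complex.exp ((β + 1) * (y / √p.1 : ℝ) - p.1 * p.2 * saddlePhase α (y / √p.1))
  let B : ℝ × ℂ → ℝ → ℂ := fun p y => Complex.exp (-(κ * p.2) * (y : ℂ) ^ 2)
  have hAc : ∀ p, Continuous (A p) := fun p => by
    have := continuous_saddlePhase α
    fun_prop
  have hBc : ∀ p, Continuous (B p) := fun p => by fun_prop
  have hdomA : Integrable fun y : ℝ => C / (1 + k * y ^ 2) := by
    have h := (integrable_inv_one_add_sq.comp_mul_left' (R := √k)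
      (Real.sqrt_ne_zero'.2 hk)).const_mul C
    refine h.congr (ae_of_all _ fun y => ?_)
    simp only [mul_pow, Real.sq_sqrt hk.le, div_eq_mul_inv]
  have hdomB : Integrable fun y : ℝ => Real.exp (-(κ * c) * y ^ 2) :=
    integrable_exp_neg_mul_sq (by positivity)
  have hev : ∀ᶠ p : ℝ × ℂ in atTop ×ˢ 𝓟 S, 2 ≤ p.1 ∧ p.2 ∈ S := by
    rw [eventually_prod_principal_iff]
    filter_upwards [eventually_ge_atTop 2] with r hr ω hω using ⟨hr, hω⟩
  have hA : ∀ p : ℝ × ℂ, 2 ≤ p.1 ∧ p.2 ∈ S → ∀ y, ‖A p y‖ ≤ C / (1 + k * y ^ 2) := by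
    rintro ⟨r, ω⟩ ⟨hr, hω⟩ y
    have hr : 2 ≤ r := hr
    refine (norm_cexp_saddle_le hα β (by linarith) hω.2).trans ((hdom r hr _).trans_eq ?_)
    rw [div_pow, Real.sq_sqrt (by linarith), mul_div_cancel₀ _ (by linarith)]
  have hBn : ∀ p : ℝ × ℂ, ∀ y : ℝ, ‖B p y‖ = Real.exp (-(κ * p.2.re) * y ^ 2) := by
    intro p y
    simp only [B, Complex.norm_exp]
    congr 1
    rw [← Complex.ofReal_pow, Complex.re_mul_ofReal]
    simp
  have hB : ∀ p : ℝ × ℂ, 2 ≤ p.1 ∧ p.2 ∈ S → ∀ y, ‖B p y‖ ≤ Real.exp (-(κ * c) * y ^ 2) := by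
    intro p hp y
    rw [hBn, Real.exp_le_exp, neg_mul, neg_mul, neg_le_neg_iff]
    gcongr
    exact hp.2.2
  have hlim : Tendsto (fun p : ℝ × ℂ => ∫ y, (A p y - B p y)) (atTop ×ˢ 𝓟 S)
      (nhds (∫ _ : ℝ, (0 : ℂ))) := by
    refine tendsto_integral_filter_of_dominated_convergence
      (fun y => C / (1 + k * y ^ 2) + Real.exp (-(κ * c) * y ^ 2)) ?_ ?_ (hdomA.add hdomB) ?_
    · exact Eventually.of_forall fun p => ((hAc p).sub (hBc p)).aestronglyMeasurable
    · filter_upwards [hev] with p hp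
      exact ae_of_all _ fun y => (norm_sub_le _ _).trans (add_le_add (hA p hp y) (hB p hp y))
    · refine ae_of_all _ fun y => ?_
      have hfst : Tendsto (fun p : ℝ × ℂ => p.1) (atTop ×ˢ 𝓟 S) atTop := tendsto_fst
      have h1 : Tendsto (fun p : ℝ × ℂ => (β + 1) * (y / √p.1 : ℝ)) (atTop ×ˢ 𝓟 S) (nhds 0) := by
        have := (Complex.continuous_ofReal.tendsto 0).comp
          ((Real.tendsto_sqrt_atTop.comp hfst).const_div_atTop y)
        simpa using this.const_mul (β + 1)
      have h2 : Tendsto (fun p : ℝ × ℂ =>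
          p.2 * ((p.1 * saddlePhase α (y / √p.1) - κ * y ^ 2 : ℝ) : ℂ))
          (atTop ×ˢ 𝓟 S) (nhds 0) := by
        have h3 := (((tendsto_mul_saddlePhase_div_sqrt α y).comp hfst).sub_const (κ * y ^ 2)).norm
        rw [sub_self, norm_zero] at h3
        refine squeeze_zero_norm' ?_ h3
        filter_upwards [hev] with p hp
        rw [norm_mul, hp.2.1, one_mul, Complex.norm_real]
        rfl
      have h4 := ((h1.sub h2).cexp.sub_const 1).norm
      simp only [Complex.exp_zero, sub_self, norm_zero] at h4
      refine squeeze_zero_norm' ?_ h4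
      filter_upwards [hev] with p hp
      have e : A p y - B p y = B p y * (Complex.exp ((β + 1) * (y / √p.1 : ℝ) -
          p.2 * ((p.1 * saddlePhase α (y / √p.1) - κ * y ^ 2 : ℝ) : ℂ)) - 1) := by
        simp only [A, B]
        rw [mul_sub, ← Complex.exp_add, mul_one]
        congr 2
        push_cast
        ring
      rw [e, norm_mul]
      refine mul_le_of_le_one_left (norm_nonneg _) ((hB p hp y).trans ?_)
      rw [Real.exp_le_one_iff, neg_mul, neg_nonpos]
      positivity
  rw [integral_zero] at hlim
  refine hlim.congr' ?_
  filter_upwards [hev] with p hp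
  have hre : 0 < (κ * p.2).re := by
    rw [Complex.re_ofReal_mul]
    exact mul_pos hκ (hc.trans_le hp.2.2)
  rw [← integral_gaussian_complex hre, integral_sub]
  · exact hdomA.mono' (hAc p).aestronglyMeasurable (ae_of_all _ (hA p hp))
  · exact integrable_cexp_neg_mul_sq hre

theorem exists_exp_sub_exp_add_exp_le {α : ℝ} (hα : 1 < α) {b c : ℝ} (hb : 0 < b) (hc : 0 < c)
    (W : ℝ) : ∃ C : ℝ, 0 < C ∧ ∀ x,
      Real.exp (b * x - c * Real.exp (α * x) + W * Real.exp x) ≤ C / (1 + x ^ 2) := by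
  have hα1 : 0 < α - 1 := by linarith
  have hα0 : 0 < α := by linarith
  set s := Real.log ((|W| + 1) / (c * α)) / (α - 1) with hs
  have hWs : (|W| + 1) * Real.exp s = c * α * Real.exp (α * s) := by
    have h1 : Real.exp ((α - 1) * s) = (|W| + 1) / (c * α) := by
      rw [hs, mul_div_cancel₀ _ hα1.ne', Real.exp_log (by positivity)]
    have h2 : Real.exp (α * s) = Real.exp ((α - 1) * s) * Real.exp s := by
      rw [← Real.exp_add]; ring_nf
    rw [h2, h1]
    field_simp
  set c' := c * Real.exp (α * s) with hc'
  obtain ⟨C, hC, h⟩ := exists_exp_sub_saddlePhase_le hα hb (show 0 < c' by positivity)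
  refine ⟨Real.exp (b * s + c' * (α - 1)) * C * (2 * (1 + s ^ 2)), by positivity, fun x => ?_⟩
  obtain ⟨y, rfl⟩ : ∃ y, x = y + s := ⟨x - s, by ring⟩
  have h1 : b * (y + s) - c * Real.exp (α * (y + s)) + W * Real.exp (y + s) ≤
      (b * s + c' * (α - 1)) + (b * y - c' * saddlePhase α y) := by
    have e : (b * s + c' * (α - 1)) + (b * y - c' * saddlePhase α y) =
        b * (y + s) - c * Real.exp (α * (y + s)) + (|W| + 1) * Real.exp (y + s) := by
      rw [mul_add α, Real.exp_add, Real.exp_add, saddlePhase, hc']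
      linear_combination -Real.exp y * hWs
    rw [e]
    have := le_abs_self W
    gcongr
    linarith
  calc _ ≤ Real.exp ((b * s + c' * (α - 1)) + (b * y - c' * saddlePhase α y)) :=
        Real.exp_le_exp.2 h1
    _ = Real.exp (b * s + c' * (α - 1)) * Real.exp (b * y - c' * saddlePhase α y) :=
        Real.exp_add _ _
    _ ≤ Real.exp (b * s + c' * (α - 1)) * (C / (1 + y ^ 2)) := by gcongr; exact h y
    _ ≤ _ := by
        rw [mul_div_assoc', div_le_div_iff₀ (by positivity) (by positivity), mul_assoc _ (2 * _)]
        gcongr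
        nlinarith [sq_nonneg (y - s), sq_nonneg (y * s)]

theorem integral_Ioi_eq_integral_exp (α : ℝ) (β v : ℂ) :
    ∫ t in Ioi (0 : ℝ), (t : ℂ) ^ β * Complex.exp (-(↑(t ^ α) : ℂ) - v * t) =
      ∫ x : ℝ, Complex.exp ((β + 1) * x - Complex.exp (α * x) + -v * Complex.exp x) := by
  have h := integral_image_eq_integral_abs_deriv_smul MeasurableSet.univ
    (fun x _ => (Real.hasDerivAt_exp x).hasDerivWithinAt) Real.exp_injective.injOn
    (fun t : ℝ => (t : ℂ) ^ β * Complex.exp (-(↑(t ^ α) : ℂ) - v * t))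
  rw [image_univ, Real.range_exp] at h
  rw [h, setIntegral_univ]
  congr 1
  ext x
  rw [Complex.cpow_def_of_ne_zero (by simp), ← Complex.ofReal_log (Real.exp_pos x).le,
    Real.log_exp, ← Real.exp_mul, abs_of_pos (Real.exp_pos x), Complex.real_smul,
    Complex.ofReal_exp, ← Complex.exp_add, ← Complex.exp_add]
  congr 1
  push_cast
  ring_nf

theorem integral_exp_eq_saddle {α : ℝ} (hα : 1 < α) {β : ℂ} (hβ : -1 < β.re) {μ ψ : ℝ}
    (hψ : α * |ψ| < Real.pi / 2) {w : ℂ}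
    (hw : w = α * Complex.exp ((α - 1) * (μ + ψ * Complex.I))) :
    ∫ x : ℝ, Complex.exp ((β + 1) * x - Complex.exp (α * x) + w * Complex.exp x) =
      Complex.exp ((β + 1) * (μ + ψ * Complex.I) +
          (α - 1) * Complex.exp (α * (μ + ψ * Complex.I))) *
        ∫ x : ℝ, Complex.exp ((β + 1) * x -
          Complex.exp (α * (μ + ψ * Complex.I)) * saddlePhase α x) := by
  have hα0 : 0 < α := by linarith
  let f : ℂ → ℂ := fun u =>
    Complex.exp ((β + 1) * u - Complex.exp (α * u) + w * Complex.exp u)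
  have hf : Differentiable ℂ f := by fun_prop
  have hcos : 0 < Real.cos (α * |ψ|) := by
    apply Real.cos_pos_of_mem_Ioo
    have : 0 ≤ α * |ψ| := by positivity
    constructor <;> linarith [Real.pi_pos]
  obtain ⟨C, hC, hbd⟩ := exists_exp_sub_exp_add_exp_le hα (show 0 < β.re + 1 by linarith) hcos ‖w‖
  have hshift := integral_add_mul_I_eq hf (C := Real.exp (|β.im| * |ψ|) * C) (ψ := ψ) ?_
  · change ∫ x : ℝ, f x = _
    rw [← hshift, ← integral_add_right_eq_self _ μ, ← integral_const_mul]
    congr 1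
    ext x
    rw [← Complex.exp_add]
    have e1 : (α : ℂ) * ((x + μ : ℝ) + ψ * Complex.I) = α * x + α * (μ + ψ * Complex.I) := by
      push_cast; ring
    have e2 : w * Complex.exp ((x + μ : ℝ) + ψ * Complex.I) =
        α * Complex.exp x * Complex.exp (α * (μ + ψ * Complex.I)) := by
      rw [hw, mul_assoc, mul_assoc, ← Complex.exp_add, ← Complex.exp_add]
      push_cast
      ring_nf
    simp only [f]
    rw [e1, e2, Complex.exp_add (α * x), saddlePhase]
    congr 1
    push_cast
    ring
  · intro x y hy
    have hy' : |y| ≤ |ψ| := by simpa using abs_sub_left_of_mem_uIcc hy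
    have hcy : Real.cos (α * |ψ|) ≤ Real.cos (α * y) := by
      rw [← Real.cos_abs (α * y), abs_mul, abs_of_pos hα0]
      apply Real.cos_le_cos_of_nonneg_of_le_pi (by positivity) (by linarith [Real.pi_pos])
      gcongr
    rw [mul_div_assoc]
    refine le_trans ?_ (mul_le_mul_of_nonneg_left (hbd x) (Real.exp_pos _).le)
    rw [← Real.exp_add, Complex.norm_exp, Real.exp_le_exp]
    have e1 : (Complex.exp (α * (x + y * Complex.I))).re =
        Real.exp (α * x) * Real.cos (α * y) := by
      rw [Complex.exp_re]; simp
    have e2 : (w * Complex.exp (x + y * Complex.I)).re ≤ ‖w‖ * Real.exp x := by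
      refine (Complex.re_le_norm _).trans_eq ?_
      rw [norm_mul, Complex.norm_exp]; simp
    have e3 : ((β + 1) * (x + y * Complex.I)).re = (β.re + 1) * x - β.im * y := by simp
    have e4 : -(β.im * y) ≤ |β.im| * |ψ| :=
      (neg_le_abs _).trans (by rw [abs_mul]; gcongr)
    rw [Complex.add_re, Complex.sub_re, e1, e3]
    have := mul_le_mul_of_nonneg_left hcy (Real.exp_pos (α * x)).le
    linarith

theorem gaussian_constant_eq {κ χ : ℝ} (hκ : 0 < κ) (hχ : |χ| < Real.pi) :
    (Real.pi / (κ / 2 * Complex.exp (χ * Complex.I))) ^ (1 / 2 : ℂ) =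
      Complex.exp ((Real.log (2 * Real.pi / κ) : ℂ) / 2 - χ / 2 * Complex.I) := by
  obtain ⟨h1, h2⟩ := abs_lt.1 hχ
  have hκ' : (κ : ℂ) ≠ 0 := Complex.ofReal_ne_zero.2 hκ.ne'
  have e : Real.pi / (κ / 2 * Complex.exp (χ * Complex.I)) =
      Complex.exp (Real.log (2 * Real.pi / κ) - χ * Complex.I) := by
    rw [Complex.exp_sub, ← Complex.ofReal_exp,
      Real.exp_log (div_pos (by positivity) hκ), div_mul_eq_div_div]
    congr 1
    push_cast
    field_simp
  rw [e, Complex.cpow_def_of_ne_zero (Complex.exp_ne_zero _),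
    Complex.log_exp (by simp; linarith) (by simp; linarith)]
  ring_nf

/-- The asymptotic constant, written in terms of the saddle point `exp (μ + ψ i)`. -/
theorem Masym_eq {α : ℝ} (hα : 1 < α) (β : ℂ) {R θ μ ψ : ℝ} (hR : 0 < R)
    (hμ : μ = Real.log (R / α) / (α - 1)) (hψ : ψ = θ / (α - 1) - Real.pi / (2 * α)) :
    Masym α β R θ =
      Complex.exp (Complex.I * Real.pi * (β + 1) / (2 * α)) *
        Complex.exp ((β + 1) * (μ + ψ * Complex.I) +
          (α - 1) * Complex.exp (α * (μ + ψ * Complex.I))) *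
        (Complex.exp (-(α * μ / 2)) * Complex.exp
          ((Real.log (2 * Real.pi / (α * (α - 1))) : ℂ) / 2 - (α * ψ : ℝ) / 2 * Complex.I)) := by
  have hα0 : 0 < α := by linarith
  have hα1 : 0 < α - 1 := by linarith
  have hαc : (α : ℂ) ≠ 0 := Complex.ofReal_ne_zero.2 hα0.ne'
  have hαc1 : (α : ℂ) - 1 ≠ 0 := by exact_mod_cast hα1.ne'
  have hlog : Real.log (2 * Real.pi / (α * (α - 1))) =
      Real.log (2 * Real.pi / (α - 1)) - Real.log α := by
    rw [← Real.log_div (by positivity) hα0.ne', div_div, mul_comm α]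
  have hsqrt : ((√(2 * Real.pi / (α - 1)) : ℝ) : ℂ) =
      Complex.exp ((Real.log (2 * Real.pi / (α - 1)) : ℂ) / 2) := by
    rw [Real.sqrt_eq_rpow, Real.rpow_def_of_pos (by positivity)]
    push_cast
    ring_nf
  have hμ' : (μ : ℂ) = (Real.log R - Real.log α) / (α - 1) := by
    rw [hμ, Real.log_div hR.ne' hα0.ne']; push_cast; ring
  have hψ' : (ψ : ℂ) = θ / (α - 1) - Real.pi / (2 * α) := by
    rw [hψ]; push_cast; ring
  have hexp : Complex.exp (Complex.I * ((α * θ / (α - 1) : ℝ) - (Real.pi : ℂ) / 2)) *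
      (↑(α ^ (-1 / (α - 1)) : ℝ) : ℂ) * (1 - 1 / (α : ℂ)) * (↑(R ^ (α / (α - 1)) : ℝ) : ℂ) =
      (α - 1) * Complex.exp (α * (μ + ψ * Complex.I)) := by
    have e1 : (1 - 1 / (α : ℂ)) = (α - 1) * Complex.exp (-Real.log α) := by
      rw [Complex.exp_neg, ← Complex.ofReal_exp, Real.exp_log hα0]
      field_simp
    rw [e1, Real.rpow_def_of_pos hα0, Real.rpow_def_of_pos hR, Complex.ofReal_exp,
      Complex.ofReal_exp]
    have e2 : ∀ a b c d : ℂ, a * b * ((α - 1) * c) * d = (α - 1) * (a * b * c * d) :=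
      fun a b c d => by ring
    rw [e2, ← Complex.exp_add, ← Complex.exp_add, ← Complex.exp_add, hμ', hψ']
    congr 2
    push_cast
    field_simp
    ring
  rw [Masym, hexp, hsqrt, Complex.cpow_def_of_ne_zero hαc,
    Complex.cpow_def_of_ne_zero (Complex.ofReal_ne_zero.2 hR.ne'), ← Complex.ofReal_log hα0.le,
    ← Complex.ofReal_log hR.le, hlog, Complex.exp_add ((β + 1) * _)]
  simp only [← Complex.exp_add]
  generalize Complex.exp (α * (μ + ψ * Complex.I)) = E
  congr 1
  rw [Complex.ofReal_mul, Complex.ofReal_sub, hμ', hψ']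
  field_simp
  ring

theorem Gab_eq {α : ℝ} (hα : 1 < α) {β : ℂ} (hβ : -1 < β.re) {R θ μ ψ : ℝ} (hR : 0 < R)
    (hμ : μ = Real.log (R / α) / (α - 1)) (hψ : ψ = θ / (α - 1) - Real.pi / (2 * α))
    (hψb : α * |ψ| < Real.pi / 2) :
    Gab α β (R * Complex.exp (Complex.I * θ)) =
      Complex.exp (Complex.I * Real.pi * (β + 1) / (2 * α)) *
        Complex.exp ((β + 1) * (μ + ψ * Complex.I) +
          (α - 1) * Complex.exp (α * (μ + ψ * Complex.I))) *
        (Complex.exp (-(α * μ / 2)) *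
          ∫ y : ℝ, Complex.exp ((β + 1) * (y / √(Real.exp (α * μ)) : ℝ) -
            Real.exp (α * μ) * Complex.exp ((α * ψ : ℝ) * Complex.I) *
              saddlePhase α (y / √(Real.exp (α * μ))))) := by
  have hα0 : 0 < α := by linarith
  have hα1 : 0 < α - 1 := by linarith
  have hαc : (α : ℂ) ≠ 0 := Complex.ofReal_ne_zero.2 hα0.ne'
  have hαc1 : (α : ℂ) - 1 ≠ 0 := by exact_mod_cast hα1.ne'
  have hψ' : (ψ : ℂ) = θ / (α - 1) - Real.pi / (2 * α) := by
    rw [hψ]; push_cast; ring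
  have hw : -(Complex.I * Complex.exp (Complex.I * Real.pi / (2 * α)) *
      (R * Complex.exp (Complex.I * θ))) =
      α * Complex.exp ((α - 1) * (μ + ψ * Complex.I)) := by
    have h1 : (α - 1 : ℂ) * (μ + ψ * Complex.I) = (Real.log (R / α) : ℝ) +
        (Complex.I * Real.pi / (2 * α) + Complex.I * θ + -(Real.pi / 2 * Complex.I)) := by
      rw [hψ', hμ]
      push_cast
      field_simp
      ring
    rw [h1, Complex.exp_add, Complex.exp_add, Complex.exp_add, ← Complex.ofReal_exp,
      Real.exp_log (by positivity), Complex.exp_neg, Complex.exp_pi_div_two_mul_I, Complex.inv_I]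
    push_cast
    field_simp
  have hscale : Complex.exp (-(α * μ / 2)) = (((√(Real.exp (α * μ)))⁻¹ : ℝ) : ℂ) := by
    rw [← Real.exp_half, ← Real.exp_neg]
    push_cast
    rfl
  have hintegral := Measure.integral_comp_div (fun x : ℝ => Complex.exp ((β + 1) * x -
    Complex.exp (α * (μ + ψ * Complex.I)) * saddlePhase α x)) √(Real.exp (α * μ))
  have hsplit : Complex.exp (α * (μ + ψ * Complex.I)) =
      Real.exp (α * μ) * Complex.exp ((α * ψ : ℝ) * Complex.I) := by
    rw [Complex.ofReal_exp, ← Complex.exp_add]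
    push_cast
    ring_nf
  have hpos : 0 < √(Real.exp (α * μ)) := Real.sqrt_pos.2 (Real.exp_pos _)
  rw [← hsplit, hintegral, hscale, abs_of_pos hpos, Complex.real_smul, ← mul_assoc (Complex.ofReal _),
    ← Complex.ofReal_mul, inv_mul_cancel₀ hpos.ne', Complex.ofReal_one, one_mul, Gab,
    integral_Ioi_eq_integral_exp, integral_exp_eq_saddle hα hβ hψb hw]
  exact (mul_assoc _ _ _).symm

theorem tendstoUniformlyOn_Gab_div_Masym {α : ℝ} (hα : 1 < α) {β : ℂ} (hβ : -1 < β.re) {ε : ℝ}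
    (hε : 0 < ε) :
    TendstoUniformlyOn
      (fun (R : ℝ) (θ : ℝ) =>
        Gab α β (R * Complex.exp (Complex.I * θ)) / Masym α β R θ)
      (fun _ => 1) atTop (Icc ε (Real.pi - Real.pi / α - ε)) := by
  have hα0 : 0 < α := by linarith
  have hα1 : 0 < α - 1 := by linarith
  rcases (Icc ε (Real.pi - Real.pi / α - ε)).eq_empty_or_nonempty with he | hne
  · rw [he]
    exact tendstoUniformlyOn_empty
  rw [nonempty_Icc] at hne
  set δ := α * ε / (α - 1) with hδ
  have hδ0 : 0 < δ := by positivity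
  have hψ : ∀ θ ∈ Icc ε (Real.pi - Real.pi / α - ε),
      α * |θ / (α - 1) - Real.pi / (2 * α)| ≤ Real.pi / 2 - δ := by
    rintro θ ⟨h1, h2⟩
    rw [← abs_of_pos hα0, ← abs_mul, abs_of_pos hα0]
    have e : α * (θ / (α - 1) - Real.pi / (2 * α)) = α * θ / (α - 1) - Real.pi / 2 := by
      field_simp
    have h3 : α * ε / (α - 1) ≤ α * θ / (α - 1) := by gcongr
    have h4 : α * θ / (α - 1) ≤ α * (Real.pi - Real.pi / α - ε) / (α - 1) := by gcongr
    have h5 : α * (Real.pi - Real.pi / α - ε) / (α - 1) = Real.pi - δ := by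
      rw [hδ]; field_simp
    rw [e, abs_le]
    constructor <;> linarith
  have hδ1 : δ ≤ Real.pi / 2 := by
    have h := hψ ε (left_mem_Icc.2 hne)
    have : 0 ≤ α * |ε / (α - 1) - Real.pi / (2 * α)| := by positivity
    linarith
  have hc : 0 < Real.sin δ := Real.sin_pos_of_pos_of_lt_pi hδ0 (by linarith [Real.pi_pos])
  set N := Real.exp (Real.log (2 * Real.pi / (α * (α - 1))) / 2) with hN
  rw [Metric.tendstoUniformlyOn_iff]
  intro e he
  have hlap := Metric.tendsto_nhds.1 (tendsto_integral_saddle_sub hα hβ hc) (e * N) (by positivity)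
  rw [eventually_prod_principal_iff] at hlap
  have hr : Tendsto (fun R : ℝ => Real.exp (α * (Real.log (R / α) / (α - 1)))) atTop atTop := by
    refine Real.tendsto_exp_atTop.comp (Tendsto.const_mul_atTop hα0 ?_)
    exact (Real.tendsto_log_atTop.comp (tendsto_id.atTop_div_const hα0)).atTop_div_const hα1
  filter_upwards [hr.eventually hlap, eventually_gt_atTop 0] with R hR hR0 θ hθ
  set μ := Real.log (R / α) / (α - 1) with hμ
  set ψ := θ / (α - 1) - Real.pi / (2 * α) with hψd
  have hψb : α * |ψ| ≤ Real.pi / 2 - δ := hψ θ hθ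
  have hχ : |α * ψ| ≤ Real.pi / 2 - δ := by rwa [abs_mul, abs_of_pos hα0]
  have hω := hR (Complex.exp ((α * ψ : ℝ) * Complex.I)) ⟨Complex.norm_exp_ofReal_mul_I _, by
    rw [Complex.exp_ofReal_mul_I_re, ← Real.cos_pi_div_two_sub, ← Real.cos_abs (α * ψ)]
    exact Real.cos_le_cos_of_nonneg_of_le_pi (abs_nonneg _) (by linarith [Real.pi_pos]) hχ⟩
  have hgc := gaussian_constant_eq (κ := α * (α - 1)) (χ := α * ψ) (by positivity)
    (by linarith [Real.pi_pos])
  push_cast at hgc hω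
  rw [hgc, dist_zero_right] at hω
  have hM := Masym_eq hα β hR0 hμ hψd
  have hG := Gab_eq hα hβ hR0 hμ hψd (by linarith)
  push_cast at hM hG
  rw [hM, hG, mul_div_mul_left _ _ (mul_ne_zero (Complex.exp_ne_zero _) (Complex.exp_ne_zero _)),
    mul_div_mul_left _ _ (Complex.exp_ne_zero _), dist_comm, dist_eq_norm,
    div_sub_one (Complex.exp_ne_zero _), norm_div, div_lt_iff₀ (by simp)]
  refine hω.trans_eq ?_
  congr 1
  rw [hN, Complex.norm_exp]
  simp

/-- In the sector `0 < θ < π − π/α`, `G_{α,β}(R e^{iθ}) ∼ M(R,θ)` as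
`R → ∞`, uniformly on closed subsectors. -/
theorem stmt_6 (α : ℝ) (hα : 1 < α) (β : ℂ) (hβ : -1 < β.re) :
    (∀ ε : ℝ, 0 < ε →
      TendstoUniformlyOn
        (fun (R : ℝ) (θ : ℝ) =>
          Gab α β (R * Complex.exp (Complex.I * θ)) / Masym α β R θ)
        (fun _ => 1) atTop (Icc ε (Real.pi - Real.pi / α - ε))) ∧
    ∀ θ : ℝ, 0 < θ → θ < Real.pi - Real.pi / α →
      Tendsto (fun R : ℝ =>
          Gab α β (R * Complex.exp (Complex.I * θ)) / Masym α β R θ)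
        atTop (nhds 1) := by
  refine ⟨fun ε hε => tendstoUniformlyOn_Gab_div_Masym hα hβ hε, fun θ h0 h1 => ?_⟩
  refine (tendstoUniformlyOn_Gab_div_Masym hα hβ
    (lt_min h0 (sub_pos.2 h1))).tendsto_at ⟨min_le_left _ _, ?_⟩
  linarith [min_le_right θ (Real.pi - Real.pi / α - θ)]
end
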